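/- arXiv:math/0606511 — 2 statements merged into one kernel-verified Lean document; each statement's English description precedes it below -/
import Mathlib

section
/- Let k be a field of positive characteristic p and R → S a surjection of graded k-algebras with R Gorenstein and S artinian. If S has finite projective dimension as an R-module, then the socles of S and of F_R^e(S) have the same k-dimension ℓ; moreover, if the socle degrees of S and of F_R^e(S) are d_1 ≤ … ≤ d_ℓ and D_1 ≤ … ≤ D_ℓ respectively, then D_i = q·d_i − (q−1)·a(R) for all i, where q = p^e. -/
open Finset CategoryTheory

section Prelim
variable {k : Type} [Field k] {R : Type} [CommRing R] [Algebra k R]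

/-- The irrelevant maximal ideal `m = ⊕_{i>0} R_i` of a graded algebra with pieces `𝒜`. -/
def irrel (𝒜 : ℕ → Submodule k R) : Ideal R :=
  Ideal.span {x : R | ∃ i, 0 < i ∧ x ∈ 𝒜 i}

/-- The degree-zero piece is exactly `k`. -/
def ZeroPieceIsBase (𝒜 : ℕ → Submodule k R) : Prop :=
  ∀ x ∈ 𝒜 0, ∃ c : k, c • (1 : R) = x

/-- The Frobenius power `I^{[q]}`, generated by the `q`-th powers of the elements of `I`. -/
def frobPow {R : Type} [CommRing R] (I : Ideal R) (q : ℕ) : Ideal R :=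
  Ideal.span ((fun x => x ^ q) '' (I : Set R))

/-- The `k`-dimension of the degree-`n` graded piece of the socle `(J : m)/J` of `R/J`. -/
noncomputable def socCount (𝒜 : ℕ → Submodule k R) (J : Ideal R) (n : ℕ) : ℕ :=
  Module.finrank k ((Submodule.restrictScalars k (J.colon (irrel 𝒜)) ⊓ 𝒜 n) : Submodule k R) -
    Module.finrank k ((Submodule.restrictScalars k J ⊓ 𝒜 n) : Submodule k R)

/-- The socle degrees of `R/J` are `d 0 ≤ … ≤ d (ℓ-1)`, as a multiset. -/
def HasSocleDegrees (𝒜 : ℕ → Submodule k R) (J : Ideal R) {ℓ : ℕ} (d : Fin ℓ → ℕ) : Prop :=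
  Monotone d ∧ ∀ n : ℕ, socCount 𝒜 J n = (univ.filter fun i => d i = n).card

/-- The Hilbert series of `R/J`. -/
noncomputable def hilbQ (𝒜 : ℕ → Submodule k R) (J : Ideal R) : PowerSeries ℤ :=
  PowerSeries.mk fun n =>
    (Module.finrank k ((𝒜 n : Submodule k R)) : ℤ) -
      (Module.finrank k ((Submodule.restrictScalars k J ⊓ 𝒜 n) : Submodule k R) : ℤ)

/-- `a` is the `a`-invariant of `R/J`: for a Cohen-Macaulay graded quotient this is
the degree of the Hilbert series of `R/J` as a rational function, which agrees with the
Goto-Watanabe `a`-invariant defined via graded local cohomology. -/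
def IsAInv (𝒜 : ℕ → Submodule k R) (J : Ideal R) (a : ℤ) : Prop :=
  ∃ num den : Polynomial ℤ, den ≠ 0 ∧
    (den : PowerSeries ℤ) * hilbQ 𝒜 J = (num : PowerSeries ℤ) ∧
    a = (num.natDegree : ℤ) - den.natDegree

/-- `R` is F-pure: if `x ∉ J` then `x^q ∉ J^{[q]}` for all `q = p^e`. -/
def IsFPureRing (R : Type) [CommRing R] (p : ℕ) : Prop :=
  ∀ (J : Ideal R) (x : R), x ∉ J → ∀ e : ℕ, x ^ p ^ e ∉ frobPow J (p ^ e)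

/-- A graded `k`-algebra is Cohen-Macaulay iff some homogeneous system of parameters is a
regular sequence. -/
def IsCMGraded (𝒜 : ℕ → Submodule k R) : Prop :=
  ∃ xs : List R, RingTheory.Sequence.IsRegular R xs ∧
    (∀ x ∈ xs, ∃ i, 0 < i ∧ x ∈ 𝒜 i) ∧
    (Ideal.span {x | x ∈ xs}).radical = irrel 𝒜

/-- A graded `k`-algebra is Gorenstein iff some homogeneous system of parameters is a
regular sequence and the (artinian) quotient by it has one-dimensional socle. -/
def IsGorensteinGraded (𝒜 : ℕ → Submodule k R) : Prop :=
  ∃ xs : List R, RingTheory.Sequence.IsRegular R xs ∧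
    (∀ x ∈ xs, ∃ i, 0 < i ∧ x ∈ 𝒜 i) ∧
    (Ideal.span {x | x ∈ xs}).radical = irrel 𝒜 ∧
    ∃ δ : ℕ, socCount 𝒜 (Ideal.span {x | x ∈ xs}) δ = 1 ∧
      ∀ n : ℕ, n ≠ δ → socCount 𝒜 (Ideal.span {x | x ∈ xs}) n = 0

/-- `x 0, …, x (ℓ-1)` is a minimal generating set for the submodule `N`. -/
def IsMinGenSet {R M : Type} [CommRing R] [AddCommGroup M] [Module R M] {ℓ : ℕ}
    (x : Fin ℓ → M) (N : Submodule R M) : Prop :=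
  Submodule.span R (Set.range x) = N ∧ ∀ i, x i ∉ Submodule.span R (x '' {j | j ≠ i})

/-- `Tor_n^R(M, N)`. -/
noncomputable def TorM (R : Type) [CommRing R] (n : ℕ) (M N : ModuleCat R) : ModuleCat R :=
  ((Tor (ModuleCat R) n).obj M).obj N

/-- `R` viewed as a module over itself via the `e`-th iterate of the Frobenius
endomorphism, i.e. `^{φ_R^e}R`. -/
noncomputable def frobMod (R : Type) [CommRing R] (p : ℕ) [ExpChar R p] (e : ℕ) : ModuleCat R :=
  (ModuleCat.restrictScalars (iterateFrobenius R p e)).obj (ModuleCat.of R R)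

/-- `M` has finite projective dimension over the graded algebra `R`: over a Noetherian
graded algebra with `R₀ = k` this is equivalent to the eventual vanishing of
`Tor_n^R(M, R/m)`, `m` the irrelevant maximal ideal. -/
def HasFinProjDim (𝒜 : ℕ → Submodule k R) (M : ModuleCat R) : Prop :=
  ∃ n : ℕ, ∀ m : ℕ, n ≤ m → Subsingleton (TorM R m M (ModuleCat.of R (R ⧸ irrel 𝒜)))

/-- The degree-`n` graded piece of the twisted graded free module `⊕_j R(-b j)`. -/
def freePiece (𝒬 : ℕ → Submodule k R) {m : ℕ} (b : Fin m → ℕ) (n : ℤ) :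
    Submodule k (Fin m → R) :=
  Submodule.pi Set.univ fun j =>
    if 0 ≤ n - (b j : ℤ) then 𝒬 (n - (b j : ℤ)).toNat else ⊥

/-- The data `(r, b, A)` is a minimal homogeneous free resolution of `R/J` of length `c`:
the `i`-th free module is `⊕_{j < r i} R(-b i j)`, and the differentials are given by the
homogeneous matrices `A i`, with entries in the irrelevant maximal ideal (minimality). -/
def IsMinGradedFreeResolution (𝒜 : ℕ → Submodule k R) (J : Ideal R) (c : ℕ)
    (r : ℕ → ℕ) (b : (i : ℕ) → Fin (r i) → ℕ)
    (A : (i : ℕ) → Matrix (Fin (r i)) (Fin (r (i + 1))) R) : Prop :=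
  r 0 = 1 ∧ (∀ j, b 0 j = 0) ∧ (∀ i, c < i → r i = 0) ∧ 0 < r c ∧
    (∀ i j l, A i j l ∈ 𝒜 (b (i + 1) l - b i j) ∧ (b (i + 1) l < b i j → A i j l = 0)) ∧
    (∀ i j l, A i j l ∈ irrel 𝒜) ∧
    (∀ i, Function.Exact (Matrix.mulVecLin (A (i + 1))) (Matrix.mulVecLin (A i))) ∧
    Function.Exact (Matrix.mulVecLin (A 0))
      ((J.mkQ).comp (∑ j : Fin (r 0), LinearMap.proj j))

end Prelim


section PartP1
open Finset CategoryTheory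
open Function TensorProduct

theorem tor_extract {R : Type} [CommRing R] (K : ModuleCat.{0} R) :
    ∃ (P : ℕ → ModuleCat.{0} R) (d : ∀ i, P (i+1) →ₗ[R] P i) (ε : P 0 →ₗ[R] K),
      (∀ i, Module.Projective R (P i)) ∧ (∀ i, Exact (d (i+1)) (d i)) ∧ Exact (d 0) ε ∧
      Surjective ε ∧
      ∀ (M : ModuleCat.{0} R) (m : ℕ), Subsingleton (TorM R (m+1) M K) →
        Exact ((d (m+1)).lTensor M) ((d m).lTensor M) := by
  let Q := projectiveResolution K
  refine ⟨fun i => Q.complex.X i, fun i => (Q.complex.d (i+1) i).hom, (Q.π.f 0).hom, ?_, ?_, ?_, ?_, ?_⟩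
  · intro i
    exact (IsProjective.iff_projective (Q.complex.X i)).mpr (Q.projective i)
  · intro i
    have := Q.exact_succ i
    rw [ShortComplex.ShortExact.moduleCat_exact_iff_function_exact] at this
    exact this
  · have := ShortComplex.exact_of_g_is_cokernel
      (ShortComplex.mk (Q.complex.d 1 0) (Q.π.f 0) Q.complex_d_comp_π_f_zero)
      Q.isColimitCokernelCofork
    rw [ShortComplex.ShortExact.moduleCat_exact_iff_function_exact] at this
    exact this
  · exact (ModuleCat.epi_iff_surjective (Q.π.f 0)).mp inferInstance
  · intro M m h
    have e := Q.isoLeftDerivedObj ((MonoidalCategory.tensoringLeft (ModuleCat R)).obj M) (m+1)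
    have hz : Limits.IsZero (TorM R (m+1) M K) := by
      exact ModuleCat.isZero_of_subsingleton _
    have := hz.of_iso e.symm
    replace this := (HomologicalComplex.exactAt_iff_isZero_homology _ _).mpr this
    rw [HomologicalComplex.exactAt_iff' _ (m+2) (m+1) m (by simp) (by simp)] at this
    rw [ShortComplex.ShortExact.moduleCat_exact_iff_function_exact] at this
    exact this

section chase
variable {R : Type} [CommRing R] {A B C P0 P1 P2 : Type}
  [AddCommGroup A] [Module R A] [AddCommGroup B] [Module R B] [AddCommGroup C] [Module R C]
  [AddCommGroup P0] [Module R P0] [AddCommGroup P1] [Module R P1] [AddCommGroup P2] [Module R P2]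

/-- Diagram chase: if `z ∈ A ⊗ P0` becomes a boundary in `B ⊗ P0`, and `C ⊗ P` is exact at `P1`,
then `z` is a boundary. -/
theorem chase1 (i : A →ₗ[R] B) (π : B →ₗ[R] C) (hi : Injective i) (hπ : Surjective π)
    (hex : Exact i π) [Module.Flat R P0] 
    (d0 : P1 →ₗ[R] P0) (d1 : P2 →ₗ[R] P1) (hd : d0 ∘ₗ d1 = 0)
    (hC : Exact (d1.lTensor C) (d0.lTensor C))
    (z : A ⊗[R] P0) (w : B ⊗[R] P1) (hw : d0.lTensor B w = i.rTensor P0 z) :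
    ∃ u : A ⊗[R] P1, d0.lTensor A u = z := by
  have inj : Injective (i.rTensor P0) := Module.Flat.rTensor_preserves_injective_linearMap i hi
  have ex : ∀ (P : Type) [AddCommGroup P] [Module R P], Exact (i.rTensor P) (π.rTensor P) :=
    fun P _ _ => rTensor_exact P hex hπ
  have c1 : d0.lTensor C (π.rTensor P1 w) = 0 := by
    have : d0.lTensor C (π.rTensor P1 w) = π.rTensor P0 (d0.lTensor B w) := by
      rw [← LinearMap.comp_apply, ← LinearMap.comp_apply, LinearMap.lTensor_comp_rTensor,
        LinearMap.rTensor_comp_lTensor]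
    rw [this, hw]
    exact (ex P0).apply_apply_eq_zero z
  obtain ⟨v, hv⟩ := (hC _).mp c1
  obtain ⟨v', rfl⟩ := LinearMap.rTensor_surjective P2 hπ v
  have : π.rTensor P1 (w - d1.lTensor B v') = 0 := by
    rw [map_sub, ← hv, sub_eq_zero, ← LinearMap.comp_apply, ← LinearMap.comp_apply,
      LinearMap.lTensor_comp_rTensor, LinearMap.rTensor_comp_lTensor]
  obtain ⟨u, hu⟩ := ((ex P1) _).mp this
  refine ⟨u, inj ?_⟩
  have h2 : i.rTensor P0 (d0.lTensor A u) = d0.lTensor B (i.rTensor P1 u) := by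
    rw [← LinearMap.comp_apply, ← LinearMap.comp_apply, LinearMap.lTensor_comp_rTensor,
        LinearMap.rTensor_comp_lTensor]
  rw [h2, hu, map_sub, hw, ← LinearMap.comp_apply, ← LinearMap.lTensor_comp, hd]
  simp

end chase

/-- Dimension shifting for Tor, packaged. -/
theorem tor_pack {R : Type} [CommRing R] (K : ModuleCat.{0} R) :
    ∃ V : ℕ → ModuleCat.{0} R → Prop,
      (∀ M m, Subsingleton (TorM R (m+1) M K) → V m M) ∧
      (∀ (A B C : ModuleCat.{0} R) (i : A →ₗ[R] B) (π : B →ₗ[R] C), Injective i → Surjective π →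
        Exact i π → Module.Flat R B →
        (∀ m, V (m+1) C → V m A) ∧ (V 0 C → Injective (i.lTensor K))) := by
  obtain ⟨P, d, ε, hP, hd, hε, hs, hT⟩ := tor_extract K
  refine ⟨fun m M => Exact ((d (m+1)).lTensor M) ((d m).lTensor M), fun M m h => hT M m h, ?_⟩
  intro A B C i π hi hπ hex hB
  have hfl : ∀ i, Module.Flat R (P i) := fun i => inferInstance
  constructor
  · intro m hC
    have hcomp : ∀ (m) (X : ModuleCat.{0} R), (d m).lTensor X ∘ₗ (d (m+1)).lTensor X = 0 := by
      intro m X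
      rw [← LinearMap.lTensor_comp, (hd m).linearMap_comp_eq_zero, LinearMap.lTensor_zero]
    intro z
    constructor
    · intro hz
      have hzB : (d m).lTensor B (i.rTensor _ z) = 0 := by
        rw [← LinearMap.comp_apply, LinearMap.lTensor_comp_rTensor,
          ← LinearMap.rTensor_comp_lTensor, LinearMap.comp_apply, hz, map_zero]
      obtain ⟨w, hw⟩ := (Module.Flat.lTensor_exact B (hd m) _).mp hzB
      exact chase1 i π hi hπ hex (d (m+1)) (d (m+2)) (hd _).linearMap_comp_eq_zero hC z w hw
    · rintro ⟨u, rfl⟩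
      exact LinearMap.congr_fun (hcomp m A) u
  · intro hC
    rw [LinearMap.lTensor_inj_iff_rTensor_inj]
    rw [← LinearMap.ker_eq_bot, LinearMap.ker_eq_bot']
    intro z hz
    obtain ⟨z', rfl⟩ := LinearMap.lTensor_surjective A hs z
    have hzB : ε.lTensor B (i.rTensor _ z') = 0 := by
        rw [← LinearMap.comp_apply, LinearMap.lTensor_comp_rTensor,
          ← LinearMap.rTensor_comp_lTensor, LinearMap.comp_apply, hz]
    obtain ⟨w, hw⟩ := (Module.Flat.lTensor_exact B hε _).mp hzB
    obtain ⟨u, rfl⟩ := chase1 i π hi hπ hex (d 0) (d 1) (hd _).linearMap_comp_eq_zero hC z' w hw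
    rw [← LinearMap.comp_apply, ← LinearMap.lTensor_comp, hε.linearMap_comp_eq_zero]
    simp

end PartP1

section PartP2
open Finset CategoryTheory
open Function TensorProduct
open scoped Pointwise

theorem mem_cons_iff {R M : Type*} [CommRing R] [AddCommGroup M] [Module R M] (y : R) (rs : List R) (x : M) :
    x ∈ (Ideal.ofList (y :: rs) • ⊤ : Submodule R M) ↔
      (Submodule.Quotient.mk x : QuotSMulTop y M) ∈ (Ideal.ofList rs • ⊤ : Submodule R (QuotSMulTop y M)) := by
  rw [Ideal.ofList_cons, Submodule.sup_smul]
  have h : (Ideal.ofList rs • ⊤ : Submodule R (QuotSMulTop y M)) =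
      ((Ideal.ofList rs • ⊤ : Submodule R M)).map (Submodule.mkQ _) := by
    rw [Submodule.map_smul'', Submodule.map_top, Submodule.range_mkQ]
  rw [h]
  have : (Submodule.Quotient.mk x : QuotSMulTop y M) = Submodule.mkQ _ x := rfl
  rw [this, ← Submodule.mem_comap, Submodule.comap_map_mkQ, Submodule.ideal_span_singleton_smul]

theorem quot_inj {R A B C : Type*} [CommRing R] [AddCommGroup A] [Module R A] [AddCommGroup B] [Module R B]
    [AddCommGroup C] [Module R C] (f : A →ₗ[R] B) (g : B →ₗ[R] C) (hf : Injective f) (hg : Surjective g)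
    (hfg : Exact f g) (y : R) (hy : IsSMulRegular C y) :
    Injective (QuotSMulTop.map y f) ∧ Surjective (QuotSMulTop.map y g) ∧
      Exact (QuotSMulTop.map y f) (QuotSMulTop.map y g) := by
  refine ⟨?_, QuotSMulTop.map_surjective y hg, QuotSMulTop.map_exact y hfg hg⟩
  rw [injective_iff_map_eq_zero]
  intro a ha
  obtain ⟨a, rfl⟩ := Submodule.Quotient.mk_surjective _ a
  have : f a ∈ y • (⊤ : Submodule R B) := by
    rw [← Submodule.Quotient.mk_eq_zero]; exact ha
  obtain ⟨b, -, hb⟩ := this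
  have h1 : y • g b = 0 := by
    have := congrArg g hb
    simpa [hfg.apply_apply_eq_zero] using this
  have h2 : g b = 0 := by
    apply hy; simpa using h1
  obtain ⟨a', rfl⟩ := (hfg b).mp h2
  rw [Submodule.Quotient.mk_eq_zero]
  refine ⟨a', trivial, hf ?_⟩
  simpa using hb

open RingTheory.Sequence

theorem reg_inter {R : Type*} [CommRing R] (rs : List R) : ∀ {A B C : Type*} [AddCommGroup A] [Module R A] [AddCommGroup B] [Module R B]
    [AddCommGroup C] [Module R C] (f : A →ₗ[R] B) (g : B →ₗ[R] C) (_ : Injective f) (_ : Surjective g)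
    (_ : Exact f g) (_ : IsWeaklyRegular C rs) (a : A), f a ∈ (Ideal.ofList rs • ⊤ : Submodule R B) →
      a ∈ (Ideal.ofList rs • ⊤ : Submodule R A) := by
  induction rs with
  | nil =>
    intro A B C _ _ _ _ _ _ f g hf hg hfg hr a ha
    simp at ha ⊢
    exact hf (by simpa using ha)
  | cons y rs ih =>
    intro A B C _ _ _ _ _ _ f g hf hg hfg hr a ha
    rw [isWeaklyRegular_cons_iff] at hr
    obtain ⟨h1, h2, h3⟩ := quot_inj f g hf hg hfg y hr.1
    rw [mem_cons_iff] at ha ⊢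
    exact ih _ _ h1 h2 h3 hr.2 _ ha

theorem reg_syz {R : Type*} [CommRing R] (rs : List R) (ys : List R) (hys : ys.length ≤ 1) : ∀ {A B C : Type*} [AddCommGroup A] [Module R A] [AddCommGroup B] [Module R B]
    [AddCommGroup C] [Module R C] (f : A →ₗ[R] B) (g : B →ₗ[R] C) (_ : Injective f) (_ : Surjective g)
    (_ : Exact f g) (_ : IsWeaklyRegular C rs), IsWeaklyRegular B (rs ++ ys) → IsWeaklyRegular A (rs ++ ys) := by
  induction rs with
  | nil =>
    intro A B C _ _ _ _ _ _ f g hf hg hfg hr hB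
    match ys, hys with
    | [], _ => simp
    | [y], _ =>
      simp only [List.nil_append, isWeaklyRegular_cons_iff] at hB ⊢
      exact ⟨IsSMulRegular.of_injective f hf hB.1, by simp⟩
  | cons y rs ih =>
    intro A B C _ _ _ _ _ _ f g hf hg hfg hr hB
    rw [isWeaklyRegular_cons_iff] at hr
    rw [List.cons_append, isWeaklyRegular_cons_iff] at hB ⊢
    obtain ⟨h1, h2, h3⟩ := quot_inj f g hf hg hfg y hr.1
    exact ⟨IsSMulRegular.of_injective f hf hB.1, ih _ _ h1 h2 h3 hr.2 hB.2⟩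

def Stab {R : Type} [CommRing R] (J : Ideal R) (M : Type) [AddCommGroup M] [Module R M] : Prop :=
  ∀ a ∈ J, ∃ (n : ℕ) (h : M →ₗ[R] (Fin n → R)) (g : (Fin n → R) →ₗ[R] M), g ∘ₗ h = a • LinearMap.id

section stab
variable {R : Type} [CommRing R] {J : Ideal R} {M : Type} [AddCommGroup M] [Module R M]

theorem stab_lift (hM : Stab J M) {r : ℕ} (π : (Fin r → R) →ₗ[R] M) (hπ : Surjective π) (a : R) (ha : a ∈ J) :
    ∃ h : M →ₗ[R] (Fin r → R), π ∘ₗ h = a • LinearMap.id := by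
  obtain ⟨n, h, g, hg⟩ := hM a ha
  obtain ⟨l, hl⟩ := Module.projective_lifting_property π g hπ
  exact ⟨l ∘ₗ h, by rw [← LinearMap.comp_assoc, hl, hg]⟩

theorem stab_ker (hM : Stab J M) {r : ℕ} (π : (Fin r → R) →ₗ[R] M) (hπ : Surjective π) :
    Stab J (LinearMap.ker π) := by
  intro a ha
  obtain ⟨h, hh⟩ := stab_lift hM π hπ a ha
  have key : ∀ x, π (h x) = a • x := fun x => LinearMap.congr_fun hh x
  refine ⟨r, (LinearMap.ker π).subtype, LinearMap.codRestrict _ (a • LinearMap.id - h ∘ₗ π) ?_, ?_⟩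
  · intro c
    simp [key]
  · ext x : 2
    simp

theorem ring_aux {E : Type*} [Ring E] (a b u : E) (h : 0 - a = b * (1 - u - 1)) : a = b * u := by
  have h4 : 1 - u - 1 = -u := by abel
  rw [h4, mul_neg, zero_sub, neg_inj] at h
  exact h

theorem step3 [IsNoetherianRing R] (m : Ideal R) [m.IsMaximal] (hJm : ∀ P : Ideal R, P.IsMaximal → J ≤ P → P = m)
    (hM : Stab J M) {r : ℕ} (π : (Fin r → R) →ₗ[R] M) (hπ : Surjective π)
    (hi : Injective ((LinearMap.ker π).subtype.lTensor (R ⧸ m))) : Module.Projective R M := by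
  let _ : Field (R ⧸ m) := Ideal.Quotient.field m
  let N := LinearMap.ker π
  let ι : N →ₗ[R] (Fin r → R) := N.subtype
  obtain ⟨ρ, hρ⟩ := LinearMap.exists_leftInverse_of_injective (ι.baseChange (R ⧸ m))
    (LinearMap.ker_eq_bot.mpr hi)
  let t : N →ₗ[R] (R ⧸ m) ⊗[R] N := TensorProduct.mk R (R ⧸ m) N 1
  have ht : Surjective t := TensorProduct.mk_surjective R N (R ⧸ m) Ideal.Quotient.mk_surjective
  obtain ⟨φ, hφ⟩ := Module.projective_lifting_property t
    ((ρ.restrictScalars R) ∘ₗ (TensorProduct.mk R (R ⧸ m) (Fin r → R) 1)) ht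
  have hφ' : ∀ x : N, t (φ (ι x)) = t x := by
    intro x
    have h1 := LinearMap.congr_fun hφ (ι x)
    have h2 := LinearMap.congr_fun hρ (1 ⊗ₜ x)
    simp at h1 h2
    simpa [t] using h1.trans h2
  have hker : ∀ x : N, t x = 0 → x ∈ (m • ⊤ : Submodule R N) := by
    intro x hx
    have := congrArg (TensorProduct.quotTensorEquivQuotSMul N m) hx
    simp [t] at this
    exact this
  let u : Module.End R N := φ ∘ₗ ι
  have hr : LinearMap.range (1 - u) ≤ m • ⊤ := by
    rintro _ ⟨x, rfl⟩
    apply hker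
    simp [u, hφ']
  obtain ⟨P, hP, -, hPc, hP0⟩ := LinearMap.exists_monic_and_natDegree_eq_and_coeff_mem_pow_and_aeval_eq_zero R (1 - u) m hr
  have he : P.eval 1 ∉ m := by
    rw [Polynomial.eval_eq_sum_range, Finset.sum_range_succ]
    simp only [one_pow, mul_one, hP.coeff_natDegree]
    intro h
    have h1 : ∑ x ∈ Finset.range P.natDegree, P.coeff x ∈ m := by
      refine Ideal.sum_mem _ fun i hi => ?_
      refine Ideal.pow_le_self ?_ (hPc i)
      have := Finset.mem_range.mp hi
      omega
    exact (Ideal.ne_top_iff_one m).mp (Ideal.IsMaximal.ne_top ‹_›) ((Ideal.add_mem_iff_right _ h1).mp h)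
  obtain ⟨Q, hQ⟩ := Polynomial.X_sub_C_dvd_sub_C_eval (a := (1:R)) (p := P)
  have hs : P.eval 1 • (1 : Module.End R N) = Polynomial.aeval (1 - u) Q * u := by
    have := congrArg (Polynomial.aeval (1 - u)) hQ
    rw [mul_comm (Polynomial.X - _) Q] at this
    simp only [map_sub, hP0, map_mul, Polynomial.aeval_C, Polynomial.aeval_X, map_one] at this
    rw [Algebra.smul_def, mul_one]
    exact ring_aux (E := Module.End R N) _ _ _ this
  let 𝔞 : Ideal R := 
    { carrier := {a | ∃ h : M →ₗ[R] (Fin r → R), π ∘ₗ h = a • LinearMap.id}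
      zero_mem' := ⟨0, by simp⟩
      add_mem' := by
        rintro a b ⟨h, hh⟩ ⟨h', hh'⟩
        exact ⟨h + h', by rw [LinearMap.comp_add, hh, hh', add_smul]⟩
      smul_mem' := by
        rintro c a ⟨h, hh⟩
        exact ⟨c • h, by rw [LinearMap.comp_smul, hh, smul_eq_mul, mul_smul]⟩ }
  have hJa : J ≤ 𝔞 := fun a ha => stab_lift hM π hπ a ha
  have hsa : P.eval 1 ∈ 𝔞 := by
    let ψ : (Fin r → R) →ₗ[R] (Fin r → R) := P.eval 1 • LinearMap.id - ι ∘ₗ (Polynomial.aeval (1 - u) Q) ∘ₗ φ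
    have hψ : LinearMap.ker π ≤ LinearMap.ker ψ := by
      intro x hx
      have := LinearMap.congr_fun hs ⟨x, hx⟩
      have h5 := congrArg ι this
      simp only [LinearMap.mem_ker, ψ, LinearMap.sub_apply, LinearMap.comp_apply]
      rw [sub_eq_zero]
      exact h5
    refine ⟨(LinearMap.ker π).liftQ ψ hψ ∘ₗ (π.quotKerEquivOfSurjective hπ).symm.toLinearMap, ?_⟩
    ext x
    obtain ⟨y, rfl⟩ := hπ x
    have h6 : (π.quotKerEquivOfSurjective hπ).symm (π y) = Submodule.Quotient.mk y := by
      rw [LinearEquiv.symm_apply_eq]; rfl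
    simp only [LinearMap.comp_apply, LinearEquiv.coe_coe, h6]
    have h7 : ((LinearMap.ker π).liftQ ψ hψ) (Submodule.Quotient.mk y) = ψ y := Submodule.liftQ_apply _ _ _
    rw [h7]
    have h8 : ∀ z : N, π (ι z) = 0 := fun z => z.2
    simp [ψ, h8]
  have htop : 𝔞 = ⊤ := by
    by_contra hne
    obtain ⟨P', hP', hle⟩ := Ideal.exists_le_maximal 𝔞 hne
    have := hJm P' hP' (hJa.trans hle)
    subst this
    exact he (hle hsa)
  obtain ⟨h, hh⟩ : (1 : R) ∈ 𝔞 := htop ▸ Submodule.mem_top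
  exact Module.Projective.of_split h π (by rw [hh, one_smul])
end stab

end PartP2

section PartP2b
open Finset CategoryTheory
open Function TensorProduct
open scoped Pointwise
open RingTheory.Sequence

theorem one_tmul_eq_zero_iff {R : Type*} [CommRing R] (m : Ideal R) {N : Type*} [AddCommGroup N] [Module R N]
    (x : N) : (1 : R ⧸ m) ⊗ₜ[R] x = 0 ↔ x ∈ (m • ⊤ : Submodule R N) := by
  rw [← (TensorProduct.quotTensorEquivQuotSMul N m).map_eq_zero_iff]
  have h3 := TensorProduct.quotTensorEquivQuotSMul_mk_tmul m (1:R) x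
  rw [map_one] at h3
  rw [h3, one_smul, Submodule.Quotient.mk_eq_zero]

theorem inj_of_elem {R : Type*} [CommRing R] (m : Ideal R) {N F : Type*} [AddCommGroup N] [Module R N]
    [AddCommGroup F] [Module R F] (ι : N →ₗ[R] F)
    (h : ∀ x : N, ι x ∈ (m • ⊤ : Submodule R F) → x ∈ (m • ⊤ : Submodule R N)) :
    Injective (ι.lTensor (R ⧸ m)) := by
  rw [injective_iff_map_eq_zero]
  intro z hz
  obtain ⟨x, rfl⟩ := TensorProduct.mk_surjective R N (R ⧸ m) Ideal.Quotient.mk_surjective z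
  rw [TensorProduct.mk_apply] at hz ⊢
  rw [LinearMap.lTensor_tmul, one_tmul_eq_zero_iff] at hz
  rw [one_tmul_eq_zero_iff]
  exact h x hz

/-- for projective modules, colon of ideals can be computed. -/
theorem proj_colon {R : Type*} [CommRing R] (I m : Ideal R) (s : R) (hs : ∀ a, s * a ∈ I → a ∈ m)
    {N : Type*} [AddCommGroup N] [Module R N] [Module.Projective R N] (x : N)
    (hx : s • x ∈ (I • ⊤ : Submodule R N)) : x ∈ (m • ⊤ : Submodule R N) := by
  obtain ⟨l, hl⟩ := (Module.projective_def (R := R) (P := N)).mp inferInstance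
  have h1 : s • l x ∈ (I • ⊤ : Submodule R (N →₀ R)) := by
    rw [← map_smul]
    exact Submodule.smul_mono le_rfl le_top (by
      rw [← Submodule.map_smul'']; exact Submodule.mem_map_of_mem hx : l (s • x) ∈ I • (Submodule.map l ⊤))
  have h2 : ∀ j, (l x) j ∈ m := by
    intro j
    apply hs
    have h3 : Finsupp.lapply (R := R) j (s • l x) ∈ (I • Submodule.map (Finsupp.lapply (R := R) (M := R) j) (⊤ : Submodule R (N →₀ R))) := by
      rw [← Submodule.map_smul'']; exact Submodule.mem_map_of_mem h1
    have h4 := Submodule.smul_mono (le_refl I) (le_top : _ ≤ (⊤ : Submodule R R)) h3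
    simpa using h4
  have h5 := hl x
  rw [← h5, Finsupp.linearCombination_apply]
  exact Submodule.sum_mem _ fun j _ => Submodule.smul_mem_smul (h2 j) trivial

theorem weaklyReg_flat {R : Type*} [CommRing R] (M : Type*) [AddCommGroup M] [Module R M] [Module.Flat R M] {xs : List R} (hxs : IsWeaklyRegular R xs) :
    IsWeaklyRegular M xs := by
  have : IsWeaklyRegular (M ⊗[R] R) xs := hxs.isWeaklyRegular_lTensor
  exact (LinearEquiv.isWeaklyRegular_congr (TensorProduct.rid R M) xs).mp this

theorem AB_base {R : Type} [CommRing R] [IsNoetherianRing R] {J : Ideal R} (m : Ideal R) [m.IsMaximal]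
    (hJm : ∀ P : Ideal R, P.IsMaximal → J ≤ P → P = m)
    (V : ℕ → ModuleCat.{0} R → Prop)
    (hV : ∀ (A B C : ModuleCat.{0} R) (i : A →ₗ[R] B) (π : B →ₗ[R] C), Injective i → Surjective π → Exact i π → Module.Flat R B →
      (∀ m, V (m+1) C → V m A) ∧ (V 0 C → Injective (i.lTensor (R ⧸ m))))
    (xs : List R) (hxs : IsWeaklyRegular R xs) (s : R) (hs : s ∉ Ideal.ofList xs) (hsm : ∀ a ∈ m, a * s ∈ Ideal.ofList xs)
    (N : ℕ) : ∀ (M : Type) [AddCommGroup M] [Module R M] [Module.Finite R M], Stab J M →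
    IsWeaklyRegular M xs → V N (ModuleCat.of R M) → Module.Projective R M := by
  induction N with
  | zero =>
    intro M _ _ _ hM hreg hv
    obtain ⟨r, π, hπ⟩ := Module.Finite.exists_fin' R M
    refine step3 m hJm hM π hπ ?_
    exact (hV (ModuleCat.of R (LinearMap.ker π)) (ModuleCat.of R (Fin r → R)) (ModuleCat.of R M) 
      (LinearMap.ker π).subtype π (Submodule.subtype_injective _) hπ (LinearMap.exact_subtype_ker_map π) (inferInstanceAs (Module.Flat R (Fin r → R)))).2 hv
  | succ N ih =>
    intro M _ _ _ hM hreg hv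
    obtain ⟨r, π, hπ⟩ := Module.Finite.exists_fin' R M
    have hex := (LinearMap.exact_subtype_ker_map π)
    have hinj := (Submodule.subtype_injective (LinearMap.ker π))
    have h1 := (hV (ModuleCat.of R (LinearMap.ker π)) (ModuleCat.of R (Fin r → R)) (ModuleCat.of R M) 
      (LinearMap.ker π).subtype π hinj hπ hex (inferInstanceAs (Module.Flat R (Fin r → R)))).1 N hv
    have hF := weaklyReg_flat (Fin r → R) hxs
    have h2 : IsWeaklyRegular (LinearMap.ker π) xs := by
      have := reg_syz xs [] (by simp) _ _ hinj hπ hex hreg (by simpa using hF)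
      simpa using this
    have h3 := ih (LinearMap.ker π) (stab_ker hM π hπ) h2 h1
    refine step3 m hJm hM π hπ (inj_of_elem m _ ?_)
    intro x hx
    apply proj_colon (Ideal.ofList xs) m s
    · intro a ha
      by_contra ham
      obtain ⟨b, c, hc, hbc⟩ := Ideal.IsMaximal.exists_inv ‹m.IsMaximal› ham
      apply hs
      have h4 := Ideal.add_mem _ (Ideal.mul_mem_left _ b ha) (hsm c hc)
      have h5 : b * (s * a) + c * s = s := by linear_combination s * hbc
      rwa [h5] at h4
    · apply reg_inter xs _ _ hinj hπ hex hreg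
      rw [map_smul]
      have h6 : s • (LinearMap.ker π).subtype x ∈ s • (m • ⊤ : Submodule R (Fin r → R)) :=
        ⟨_, hx, rfl⟩
      rw [← Submodule.ideal_span_singleton_smul, ← Submodule.mul_smul] at h6
      refine Submodule.smul_mono_left ?_ h6
      rw [Ideal.span_singleton_mul_le_iff]
      intro a ha
      rw [mul_comm]; exact hsm a ha

theorem AB {R : Type} [CommRing R] [IsNoetherianRing R] {J : Ideal R} (m : Ideal R) [m.IsMaximal]
    (hJm : ∀ P : Ideal R, P.IsMaximal → J ≤ P → P = m)
    (V : ℕ → ModuleCat.{0} R → Prop)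
    (hV : ∀ (A B C : ModuleCat.{0} R) (i : A →ₗ[R] B) (π : B →ₗ[R] C), Injective i → Surjective π → Exact i π → Module.Flat R B →
      (∀ m, V (m+1) C → V m A) ∧ (V 0 C → Injective (i.lTensor (R ⧸ m))))
    (xs : List R) (hxs : IsWeaklyRegular R xs) (s : R) (hs : s ∉ Ideal.ofList xs) (hsm : ∀ a ∈ m, a * s ∈ Ideal.ofList xs)
    (j : ℕ) : ∀ (N i : ℕ) (M : Type) [AddCommGroup M] [Module R M] [Module.Finite R M], Stab J M →
    IsWeaklyRegular M (xs.take i) → i + j = xs.length → V N (ModuleCat.of R M) → HasProjectiveDimensionLT (ModuleCat.of R M) (j + 1) := by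
  induction j with
  | zero =>
    intro N i M _ _ _ hM hreg hij hv
    rw [List.take_of_length_le (by omega)] at hreg
    have := AB_base m hJm V hV xs hxs s hs hsm N M hM hreg hv
    rw [zero_add, ← projective_iff_hasProjectiveDimensionLT_one]
    infer_instance
  | succ j ih =>
    intro N i M _ _ _ hM hreg hij hv
    obtain ⟨r, π, hπ⟩ := Module.Finite.exists_fin' R M
    have hex := (LinearMap.exact_subtype_ker_map π)
    have hinj := (Submodule.subtype_injective (LinearMap.ker π))
    have h0 := (hV (ModuleCat.of R (LinearMap.ker π)) (ModuleCat.of R (Fin r → R)) (ModuleCat.of R M) 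
      (LinearMap.ker π).subtype π hinj hπ hex (inferInstanceAs (Module.Flat R (Fin r → R))))
    cases N with
    | zero =>
      have : Module.Projective R M := step3 m hJm hM π hπ (h0.2 hv)
      have : HasProjectiveDimensionLT (ModuleCat.of R M) 1 := by
        rw [← projective_iff_hasProjectiveDimensionLT_one]
        infer_instance
      exact hasProjectiveDimensionLT_of_ge _ 1 _ (by omega)
    | succ N =>
      have hF := weaklyReg_flat (Fin r → R) hxs
      have hlt : i < xs.length := by omega
      have htake : xs.take (i+1) = xs.take i ++ [xs[i]] := by
        rw [List.take_append_getElem]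
      have h2 : IsWeaklyRegular (LinearMap.ker π) (xs.take (i+1)) := by
        rw [htake]
        apply reg_syz (xs.take i) [xs[i]] (by simp) _ _ hinj hπ hex hreg
        rw [← htake]
        rw [← List.take_append_drop (i+1) xs] at hF
        exact ((isWeaklyRegular_append_iff _ _ _).mp hF).1
      have h3 := ih N (i+1) (LinearMap.ker π) (stab_ker hM π hπ) h2 (by omega) (h0.1 N hv)
      let S : ShortComplex (ModuleCat.{0} R) := ShortComplex.mk (ModuleCat.ofHom (LinearMap.ker π).subtype) (ModuleCat.ofHom π) (by
        ext x; exact x.2)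
      have hS : S.ShortExact := ModuleCat.shortComplex_shortExact S hex hinj hπ
      have hP : HasProjectiveDimensionLT (ModuleCat.of R (Fin r → R)) 1 := by
        rw [← projective_iff_hasProjectiveDimensionLT_one]
        infer_instance
      exact hS.hasProjectiveDimensionLT_X₃ (j+1) h3 (hasProjectiveDimensionLT_of_ge _ 1 _ (by omega))

theorem T1 {k R : Type} [Field k] [CommRing R] [Algebra k R] [IsNoetherianRing R]
    (𝒜 : ℕ → Submodule k R) [hmax : (irrel 𝒜).IsMaximal] (J : Ideal R) (hart : J.radical = irrel 𝒜)
    (hpd : HasFinProjDim 𝒜 (ModuleCat.of R (R ⧸ J)))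
    (xs : List R) (hxs : IsWeaklyRegular R xs) (s : R) (hs : s ∉ Ideal.ofList xs)
    (hsm : ∀ a ∈ irrel 𝒜, a * s ∈ Ideal.ofList xs) :
    HasProjectiveDimensionLT (ModuleCat.of R (R ⧸ J)) (xs.length + 1) := by
  obtain ⟨V, hV1, hV2⟩ := tor_pack (ModuleCat.of R (R ⧸ irrel 𝒜))
  obtain ⟨N, hN⟩ := hpd
  refine AB (J := J) (irrel 𝒜) ?_ V hV2 xs hxs s hs hsm xs.length N 0 (R ⧸ J) ?_ (by simp) (by simp)
    (hV1 _ _ (hN _ (by omega)))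
  · intro P hP hJP
    have : irrel 𝒜 ≤ P := by
      rw [← hart]; exact hP.isPrime.radical_le_iff.mpr hJP
    exact (hmax.eq_of_le hP.ne_top this).symm
  · intro a ha
    refine ⟨0, 0, 0, ?_⟩
    ext
    have h : Ideal.Quotient.mk J a = 0 := Ideal.Quotient.eq_zero_iff_mem.mpr ha
    have h2 : a • (1 : R ⧸ J) = 0 := by rw [Algebra.smul_def, mul_one]; exact h
    exact h2.symm

end PartP2b

section PartP3
open Finset CategoryTheory
open Function TensorProduct
open scoped Pointwise
open RingTheory.Sequence
open CategoryTheory.Abelian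

theorem ext_smul_zero {R : Type} [CommRing R] {J : Ideal R} {y : R} (hy : y ∈ J) (M : ModuleCat.{0} R) (i : ℕ)
    (x : Ext (ModuleCat.of R (R ⧸ J)) M i) : x.comp (Ext.mk₀ (M.smulShortComplex y).f) (add_zero i) = 0 := by
  have hann : y ∈ Module.annihilator R (ModuleCat.of R (R ⧸ J)) := by
    change y ∈ Module.annihilator R (R ⧸ J)
    rwa [Ideal.annihilator_quotient]
  have := Ext.postcomp_smul_id_eq_zero_of_mem_annihilator (M := M) hann i
  exact DFunLike.congr_fun (congrArg (fun g => g.hom) this) x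

theorem ext_step1 {C : Type*} [Category C] [Abelian C] [HasExt C] {S : ShortComplex C} (hS : S.ShortExact) (X : C) (i : ℕ)
    (hz : ∀ x : Ext X S.X₃ i, x = 0) (x : Ext X S.X₁ (i+1)) (hx : x.comp (Ext.mk₀ S.f) (add_zero _) = 0) : x = 0 := by
  obtain ⟨x3, h3⟩ := Ext.covariant_sequence_exact₁ _ hS x hx rfl
  rw [← h3, hz x3, Ext.zero_comp]

theorem ext_step2 {C : Type*} [Category C] [Abelian C] [HasExt C] {S₁ S₂ : ShortComplex C} (h₁ : S₁.ShortExact) (h₂ : S₂.ShortExact)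
    (φ : S₁ ⟶ S₂) (X : C) (n : ℕ) (h0 : ∀ u : Ext X S₂.X₂ n, u = 0)
    (hkill : ∀ w : Ext X S₁.X₁ (n+1), w.comp (Ext.mk₀ S₁.f) (add_zero _) = 0)
    (hs : ∀ z : Ext X S₂.X₁ (n+1), ∃ w : Ext X S₁.X₁ (n+1), w.comp (Ext.mk₀ φ.τ₁) (add_zero _) = z)
    (z : Ext X S₂.X₃ n) : ∃ v : Ext X S₁.X₃ n, v.comp (Ext.mk₀ φ.τ₃) (add_zero _) = z := by
  have hnat := ShortComplex.ShortExact.extClass_naturality h₁ h₂ φ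
  obtain ⟨w, hw⟩ := hs (z.comp h₂.extClass rfl)
  obtain ⟨v, hv⟩ := Ext.covariant_sequence_exact₁ _ h₁ w (hkill w) rfl
  have hh : (z - v.comp (Ext.mk₀ φ.τ₃) (add_zero _)).comp h₂.extClass rfl = 0 := by
    rw [sub_eq_add_neg, Ext.add_comp, Ext.neg_comp, ← sub_eq_add_neg, ← hw, ← hv, sub_eq_zero, Ext.comp_assoc_of_third_deg_zero, hnat, Ext.comp_assoc_of_second_deg_zero]
  obtain ⟨u, hu⟩ := Ext.covariant_sequence_exact₃ _ h₂ _ rfl hh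
  rw [h0 u, Ext.zero_comp] at hu
  exact ⟨v, (sub_eq_zero.mp hu.symm).symm⟩

theorem ext_van {R : Type} [CommRing R] (J : Ideal R) (rs : List R) : ∀ (M : ModuleCat.{0} R), (∀ r ∈ rs, r ∈ J) →
    IsWeaklyRegular M rs → ∀ i < rs.length, ∀ x : Ext (ModuleCat.of R (R ⧸ J)) M i, x = 0 := by
  induction rs with
  | nil => intro M _ _ i hi; simp at hi
  | cons y rs ih =>
    intro M hJ hreg i hi x
    rw [isWeaklyRegular_cons_iff] at hreg
    have hS := hreg.1.smulShortComplex_shortExact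
    have hx := ext_smul_zero (hJ y (by simp)) M i x
    cases i with
    | zero =>
      have := hS.mono_f
      apply Ext.postcomp_mk₀_injective_of_mono _ (M.smulShortComplex y).f
      exact hx.trans (map_zero _).symm
    | succ i =>
      exact ext_step1 hS _ i (ih (ModuleCat.of R (QuotSMulTop y M)) (fun r hr => hJ r (by simp [hr])) hreg.2 i (by simpa using hi)) x hx

theorem T2aux {R : Type} [CommRing R] (J : Ideal R) (rs : List R) : ∀ (X Y : Type) [AddCommGroup X] [Module R X]
    [AddCommGroup Y] [Module R Y] (f : X →ₗ[R] Y), (∀ r ∈ rs, r ∈ J) →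
    IsWeaklyRegular X rs → IsWeaklyRegular Y rs →
    (∀ z : Ext (ModuleCat.of R (R ⧸ J)) (ModuleCat.of R Y) rs.length, ∃ w : Ext (ModuleCat.of R (R ⧸ J)) (ModuleCat.of R X) rs.length,
      w.comp (Ext.mk₀ (ModuleCat.ofHom f)) (add_zero _) = z) →
    ∀ y : Y, (∀ j ∈ J, j • y ∈ (Ideal.ofList rs • ⊤ : Submodule R Y)) →
    ∃ x : X, (∀ j ∈ J, j • x ∈ (Ideal.ofList rs • ⊤ : Submodule R X)) ∧ f x - y ∈ (Ideal.ofList rs • ⊤ : Submodule R Y) := by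
  induction rs with
  | nil =>
    intro X Y _ _ _ _ f _ _ _ hs y hy
    simp only [Ideal.ofList_nil, Submodule.bot_smul, Submodule.mem_bot] at hy ⊢
    let g : (R ⧸ J) →ₗ[R] Y := Submodule.liftQ J (LinearMap.toSpanSingleton R Y y) (by
      intro j hj; simpa using hy j hj)
    obtain ⟨w, hw⟩ := hs (Ext.mk₀ (ModuleCat.ofHom g))
    obtain ⟨h, rfl⟩ := (Ext.mk₀_bijective _ _).2 w
    simp only [Ext.mk₀_comp_mk₀] at hw
    have hw2 := (Ext.mk₀_bijective _ _).1 hw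
    refine ⟨h.hom (Submodule.Quotient.mk 1), ?_, ?_⟩
    · intro j hj
      rw [← map_smul]
      have : j • (Submodule.Quotient.mk 1 : R ⧸ J) = 0 := by
        rw [← Submodule.Quotient.mk_smul, Submodule.Quotient.mk_eq_zero]; simpa using hj
      rw [this, map_zero]
    · have := LinearMap.congr_fun (congrArg (fun g => g.hom) hw2) (Submodule.Quotient.mk 1)
      rw [sub_eq_zero]
      refine this.trans ?_
      change g (Submodule.Quotient.mk 1) = y
      exact (Submodule.liftQ_apply _ _ _).trans (one_smul R y)
  | cons r rs ih =>
    intro X Y _ _ _ _ f hJ hX hY hs y hy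
    rw [isWeaklyRegular_cons_iff] at hX hY
    have hSX := IsSMulRegular.smulShortComplex_shortExact (M := ModuleCat.of R X) hX.1
    have hSY := IsSMulRegular.smulShortComplex_shortExact (M := ModuleCat.of R Y) hY.1
    let φ : (ModuleCat.of R X).smulShortComplex r ⟶ (ModuleCat.of R Y).smulShortComplex r :=
      { τ₁ := ModuleCat.ofHom f
        τ₂ := ModuleCat.ofHom f
        τ₃ := ModuleCat.ofHom (QuotSMulTop.map r f)
        comm₁₂ := by ext x; exact (map_smul f r x).symm
        comm₂₃ := by ext x; rfl }
    obtain ⟨x, hx1, hx2⟩ := ih (QuotSMulTop r X) (QuotSMulTop r Y) (QuotSMulTop.map r f) (fun a ha => hJ a (by simp [ha])) hX.2 hY.2 (by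
      exact ext_step2 hSX hSY φ _ _ (ext_van J (r :: rs) (ModuleCat.of R Y) hJ (by rw [isWeaklyRegular_cons_iff]; exact hY) _ (by simp))
        (ext_smul_zero (hJ r (by simp)) _ _) hs) (Submodule.Quotient.mk y) (by
      intro j hj
      have := hy j hj
      rw [mem_cons_iff] at this
      exact this)
    obtain ⟨x, rfl⟩ := Submodule.Quotient.mk_surjective _ x
    refine ⟨x, ?_, ?_⟩
    · intro j hj
      rw [mem_cons_iff]
      exact hx1 j hj
    · rw [mem_cons_iff]
      exact hx2

theorem T2 {R : Type} [CommRing R] (J : Ideal R) (rs : List R) (hpd : HasProjectiveDimensionLT (ModuleCat.of R (R ⧸ J)) (rs.length + 1))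
    (X Y : Type) [AddCommGroup X] [Module R X]
    [AddCommGroup Y] [Module R Y] (f : X →ₗ[R] Y) (hf : Surjective f) (hJ : ∀ r ∈ rs, r ∈ J)
    (hX : IsWeaklyRegular X rs) (hY : IsWeaklyRegular Y rs)
    (y : Y) (hy : ∀ j ∈ J, j • y ∈ (Ideal.ofList rs • ⊤ : Submodule R Y)) :
    ∃ x : X, (∀ j ∈ J, j • x ∈ (Ideal.ofList rs • ⊤ : Submodule R X)) ∧ f x - y ∈ (Ideal.ofList rs • ⊤ : Submodule R Y) := by
  refine T2aux J rs X Y f hJ hX hY ?_ y hy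
  intro z
  have hS := LinearMap.shortExact_shortComplexKer hf
  exact Ext.covariant_sequence_exact₃ _ hS z rfl (Ext.eq_zero_of_hasProjectiveDimensionLT _ (rs.length + 1) le_rfl)

end PartP3

section PartP4
open Finset CategoryTheory
open Function TensorProduct
open scoped Pointwise
open RingTheory.Sequence

theorem free_mem {R : Type*} [CommRing R] (I : Ideal R) {σ : Type*} (z : σ →₀ R) :
    z ∈ (I • ⊤ : Submodule R (σ →₀ R)) ↔ ∀ i, z i ∈ I := by
  constructor
  · intro hz i
    have h3 : Finsupp.lapply (R := R) i z ∈ (I • Submodule.map (Finsupp.lapply (R := R) (M := R) i) (⊤ : Submodule R (σ →₀ R))) := by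
      rw [← Submodule.map_smul'']; exact Submodule.mem_map_of_mem hz
    have h4 := Submodule.smul_mono (le_refl I) (le_top : _ ≤ (⊤ : Submodule R R)) h3
    simpa using h4
  · intro h
    rw [← Finsupp.sum_single z]
    refine Submodule.sum_mem _ fun i _ => ?_
    have : Finsupp.single i (z i) = z i • Finsupp.single i (1:R) := by simp
    rw [this]
    exact Submodule.smul_mem_smul (h i) trivial

theorem map_mem_smul_top {R M N : Type*} [CommRing R] [AddCommGroup M] [Module R M] [AddCommGroup N] [Module R N]
    (I : Ideal R) (f : M →ₗ[R] N) {x : M} (hx : x ∈ (I • ⊤ : Submodule R M)) : f x ∈ (I • ⊤ : Submodule R N) :=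
  Submodule.smul_mono le_rfl le_top (by
      rw [← Submodule.map_smul'']; exact Submodule.mem_map_of_mem hx : f x ∈ I • (Submodule.map f ⊤))

theorem surj_claim {R : Type} [CommRing R] (J : Ideal R) (rs : List R) (hpd : HasProjectiveDimensionLT (ModuleCat.of R (R ⧸ J)) (rs.length + 1))
    (hJ : ∀ r ∈ rs, r ∈ J) (hR : IsWeaklyRegular R rs) (I : Ideal R) (hI : ∀ a, a ∈ I ↔ ∀ j ∈ J, j * a ∈ Ideal.ofList rs)
    (X : Type) [AddCommGroup X] [Module R X] (hX : IsWeaklyRegular X rs)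
    (x : X) (hx : ∀ j ∈ J, j • x ∈ (Ideal.ofList rs • ⊤ : Submodule R X)) : x ∈ (I • ⊤ : Submodule R X) := by
  obtain ⟨z, hz1, hz2⟩ := T2 J rs hpd (X →₀ R) X (Finsupp.linearCombination R id) 
    (Finsupp.linearCombination_surjective R surjective_id) hJ (weaklyReg_flat _ hR) hX x hx
  have hz : z ∈ (I • ⊤ : Submodule R (X →₀ R)) := by
    rw [free_mem]
    intro i
    rw [hI]
    intro j hj
    have := (free_mem _ _).mp (hz1 j hj) i
    simpa using this
  have h1 := map_mem_smul_top I (Finsupp.linearCombination R (id : X → X)) hz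
  have hle : Ideal.ofList rs ≤ I := by
    intro a ha
    rw [hI]
    intro j _
    exact Ideal.mul_mem_left _ _ ha
  have h2 := Submodule.smul_mono_left hle hz2
  have := Submodule.sub_mem _ h1 h2
  simpa using this

theorem C1 {R B : Type} [CommRing R] [CommRing B] (φ : R →+* B) (J : Ideal R) (rs : List R) (hpd : HasProjectiveDimensionLT (ModuleCat.of R (R ⧸ J)) (rs.length + 1))
    (hJ : ∀ r ∈ rs, r ∈ J) (hR : IsWeaklyRegular R rs) (I : Ideal R) (hI : ∀ a, a ∈ I ↔ ∀ j ∈ J, j * a ∈ Ideal.ofList rs)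
    (hB : IsWeaklyRegular B (rs.map φ)) (b : B) (hb : ∀ j ∈ J, φ j * b ∈ Ideal.map φ (Ideal.ofList rs)) :
    b ∈ Ideal.map φ I := by
  algebraize [φ]
  have hB' : IsWeaklyRegular B rs := (isWeaklyRegular_map_algebraMap_iff B B rs).mp hB
  have := surj_claim J rs hpd hJ hR I hI B hB' b (by
    intro j hj
    rw [Ideal.smul_top_eq_map, Algebra.smul_def]
    exact hb j hj)
  rw [Ideal.smul_top_eq_map] at this
  exact this

theorem mem_sup_smul {R : Type*} [CommRing R] {σ : Type*} [Fintype σ] (g : σ → R) (L : Ideal R) {M : Type*} [AddCommGroup M] [Module R M]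
    (x : M) (hx : x ∈ ((Ideal.span (Set.range g) ⊔ L) • ⊤ : Submodule R M)) :
    ∃ κ : σ → M, x - ∑ i, g i • κ i ∈ (L • ⊤ : Submodule R M) := by
  rw [Submodule.sup_smul] at hx
  obtain ⟨u, hu, v, hv, rfl⟩ := Submodule.mem_sup.mp hx
  have : ∃ κ : σ → M, u = ∑ i, g i • κ i := by
    clear hx hv
    induction hu using Submodule.smul_induction_on' with
    | smul r hr n hn =>
      obtain ⟨c, hc⟩ := Ideal.mem_span_range_iff_exists_fun.mp hr
      refine ⟨fun i => c i • n, ?_⟩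
      rw [← hc, Finset.sum_smul]
      refine Finset.sum_congr rfl fun i _ => ?_
      rw [smul_smul, mul_comm]
    | add x hx y hy h1 h2 =>
      obtain ⟨k1, rfl⟩ := h1
      obtain ⟨k2, rfl⟩ := h2
      exact ⟨k1 + k2, by simp [Finset.sum_add_distrib]⟩
  obtain ⟨κ, rfl⟩ := this
  exact ⟨κ, by simpa using hv⟩

theorem syz_ker {R X B : Type} [CommRing R] [AddCommGroup B] [Module R B] [AddCommGroup X] [Module R X] (f : X →ₗ[R] B)
    (hf : Surjective f) (rs : List R) (hX : IsWeaklyRegular X rs) (hB : IsWeaklyRegular B rs) : IsWeaklyRegular (LinearMap.ker f) rs := by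
  have hex := (LinearMap.exact_subtype_ker_map f)
  have hinj := (Submodule.subtype_injective (LinearMap.ker f))
  have := reg_syz rs [] (by simp) (LinearMap.ker f).subtype f hinj hf hex hB (by simpa using hX)
  simpa using this

theorem inter_ker {R X B : Type} [CommRing R] [AddCommGroup B] [Module R B] [AddCommGroup X] [Module R X] (f : X →ₗ[R] B)
    (hf : Surjective f) (rs : List R) (hB : IsWeaklyRegular B rs) (x : LinearMap.ker f)
    (hx : (x : X) ∈ (Ideal.ofList rs • ⊤ : Submodule R X)) : x ∈ (Ideal.ofList rs • ⊤ : Submodule R (LinearMap.ker f)) := by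
  have hex := (LinearMap.exact_subtype_ker_map f)
  have hinj := (Submodule.subtype_injective (LinearMap.ker f))
  exact reg_inter rs (LinearMap.ker f).subtype f hinj hf hex hB x hx

theorem C2abs {R X B : Type} [CommRing R] [AddCommGroup X] [Module R X] [AddCommGroup B] [Module R B] (J : Ideal R) (rs : List R) (hpd : HasProjectiveDimensionLT (ModuleCat.of R (R ⧸ J)) (rs.length + 1))
    (hJ : ∀ r ∈ rs, r ∈ J) (hR : IsWeaklyRegular R rs) (I : Ideal R) (hI : ∀ a, a ∈ I ↔ ∀ j ∈ J, j * a ∈ Ideal.ofList rs)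
    (hB' : IsWeaklyRegular B rs) (hX : IsWeaklyRegular X rs) (f : X →ₗ[R] B) (hf : Surjective f)
    (𝔪 : Ideal R) {σ : Type} [Fintype σ] (g : σ → R)
    (hg : I = Ideal.span (Set.range g) ⊔ Ideal.ofList rs)
    (hmin : ∀ c : σ → X, ∑ i, g i • c i ∈ (Ideal.ofList rs • ⊤ : Submodule R X) → ∀ i, c i ∈ (𝔪 • ⊤ : Submodule R X))
    (b : σ → B) (hb : ∑ i, g i • b i ∈ (Ideal.ofList rs • ⊤ : Submodule R B)) (i : σ) : b i ∈ (𝔪 • ⊤ : Submodule R B) := by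
  choose c hc using fun i => hf (b i)
  have hK : IsWeaklyRegular (LinearMap.ker f) rs := syz_ker f hf rs hX hB'
  have hz : f (∑ i, g i • c i) ∈ (Ideal.ofList rs • ⊤ : Submodule R B) := by
    simpa only [map_sum, map_smul, hc] using hb
  have hw : ∃ w ∈ (Ideal.ofList rs • ⊤ : Submodule R X), f w = f (∑ i, g i • c i) := by
    have : (Ideal.ofList rs • ⊤ : Submodule R B) = Submodule.map f (Ideal.ofList rs • ⊤ : Submodule R X) := by
      rw [Submodule.map_smul'', Submodule.map_top, LinearMap.range_eq_top.mpr hf]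
    rw [this] at hz
    exact hz
  obtain ⟨w, hw1, hw2⟩ := hw
  let κ : LinearMap.ker f := ⟨∑ i, g i • c i - w, by rw [LinearMap.mem_ker, map_sub, hw2, sub_self]⟩
  have hκ : κ ∈ (I • ⊤ : Submodule R (LinearMap.ker f)) := by
    apply surj_claim J rs hpd hJ hR I hI _ hK
    intro j hj
    apply inter_ker f hf rs hB'
    change j • (∑ i, g i • c i - w) ∈ _
    rw [smul_sub, Finset.smul_sum]
    refine Submodule.sub_mem _ (Submodule.sum_mem _ fun i _ => ?_) (Submodule.smul_mem _ _ hw1)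
    rw [smul_smul]
    refine Submodule.smul_mem_smul ?_ trivial
    refine (hI (g i)).mp ?_ j hj
    rw [hg]
    exact Ideal.mem_sup_left (Ideal.subset_span ⟨i, rfl⟩)
  rw [hg] at hκ
  obtain ⟨κ', hκ'⟩ := mem_sup_smul g _ κ hκ
  have h1 := map_mem_smul_top _ (LinearMap.ker f).subtype hκ'
  have h2 := Submodule.add_mem _ h1 hw1
  have h3 : (LinearMap.ker f).subtype (κ - ∑ i, g i • κ' i) + w = ∑ i, g i • (c i - (κ' i : X)) := by
    simp [κ, smul_sub, Finset.sum_sub_distrib]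
    abel
  rw [h3] at h2
  have h4 := hmin _ h2 i
  have h5 := map_mem_smul_top _ f h4
  rw [map_sub, hc, (κ' i).2, sub_zero] at h5
  exact h5


theorem C2core {R B : Type} [CommRing R] [AddCommGroup B] [Module R B] (J : Ideal R) (rs : List R) (hpd : HasProjectiveDimensionLT (ModuleCat.of R (R ⧸ J)) (rs.length + 1))
    (hJ : ∀ r ∈ rs, r ∈ J) (hR : IsWeaklyRegular R rs) (I : Ideal R) (hI : ∀ a, a ∈ I ↔ ∀ j ∈ J, j * a ∈ Ideal.ofList rs)
    (hB' : IsWeaklyRegular B rs) (𝔪 : Ideal R) {σ : Type} [Fintype σ] (g : σ → R)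
    (hg : I = Ideal.span (Set.range g) ⊔ Ideal.ofList rs)
    (hmin : ∀ c : σ → R, ∑ i, c i * g i ∈ Ideal.ofList rs → ∀ i, c i ∈ 𝔪)
    (b : σ → B) (hb : ∑ i, g i • b i ∈ (Ideal.ofList rs • ⊤ : Submodule R B)) (i : σ) : b i ∈ (𝔪 • ⊤ : Submodule R B) := by
  refine C2abs (X := B →₀ R) J rs hpd hJ hR I hI hB' (weaklyReg_flat _ hR) (Finsupp.linearCombination R id)
    (Finsupp.linearCombination_surjective R surjective_id) 𝔪 g hg ?_ b hb i
  intro c h2 i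
  rw [free_mem] at h2 ⊢
  intro β
  refine hmin (fun i => c i β) ?_ i
  have := h2 β
  simp only [Finsupp.coe_finsetSum, Finset.sum_apply, Finsupp.smul_apply, smul_eq_mul] at this
  simpa only [mul_comm] using this

theorem C2 {R B : Type} [CommRing R] [CommRing B] (φ : R →+* B) (J : Ideal R) (rs : List R) (hpd : HasProjectiveDimensionLT (ModuleCat.of R (R ⧸ J)) (rs.length + 1))
    (hJ : ∀ r ∈ rs, r ∈ J) (hR : IsWeaklyRegular R rs) (I : Ideal R) (hI : ∀ a, a ∈ I ↔ ∀ j ∈ J, j * a ∈ Ideal.ofList rs)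
    (hB : IsWeaklyRegular B (rs.map φ)) (𝔪 : Ideal R) {σ : Type} [Fintype σ] (g : σ → R)
    (hg : I = Ideal.span (Set.range g) ⊔ Ideal.ofList rs)
    (hmin : ∀ c : σ → R, ∑ i, c i * g i ∈ Ideal.ofList rs → ∀ i, c i ∈ 𝔪)
    (b : σ → B) (hb : ∑ i, b i * φ (g i) ∈ Ideal.map φ (Ideal.ofList rs)) (i : σ) : b i ∈ Ideal.map φ 𝔪 := by
  algebraize [φ]
  have hB' : IsWeaklyRegular B rs := (isWeaklyRegular_map_algebraMap_iff B B rs).mp hB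
  have := C2core J rs hpd hJ hR I hI hB' 𝔪 g hg hmin b (by
    rw [Ideal.smul_top_eq_map]
    simp only [Algebra.smul_def]
    simp only [mul_comm] at hb ⊢
    exact hb) i
  rw [Ideal.smul_top_eq_map] at this
  exact this

end PartP4

section PartP5a
open Finset CategoryTheory

set_option linter.unusedSectionVars false
set_option linter.unusedVariables false
section P5a
variable {k R : Type} [Field k] [CommRing R] [Algebra k R] (𝒜 : ℕ → Submodule k R) [GradedAlgebra 𝒜]

theorem pj_mem (i : ℕ) (x : R) : GradedRing.proj 𝒜 i x ∈ 𝒜 i := by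
  rw [GradedRing.proj_apply]; exact SetLike.coe_mem _

theorem pj_same {i : ℕ} {x : R} (h : x ∈ 𝒜 i) : GradedRing.proj 𝒜 i x = x := by
  rw [GradedRing.proj_apply]; exact DirectSum.decompose_of_mem_same 𝒜 h

theorem pj_ne {i j : ℕ} {x : R} (h : x ∈ 𝒜 i) (hij : i ≠ j) : GradedRing.proj 𝒜 j x = 0 := by
  rw [GradedRing.proj_apply]; exact DirectSum.decompose_of_mem_ne 𝒜 h hij

theorem pj_mul {e n : ℕ} (a : R) {z : R} (h : z ∈ 𝒜 e) :
    GradedRing.proj 𝒜 n (a * z) = if e ≤ n then GradedRing.proj 𝒜 (n - e) a * z else 0 := by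
  simp only [GradedRing.proj_apply]; exact DirectSum.coe_decompose_mul_of_right_mem 𝒜 n h

theorem pj_homog {Z : Ideal R} (hZ : Z.IsHomogeneous 𝒜) {x : R} (hx : x ∈ Z) (i : ℕ) :
    GradedRing.proj 𝒜 i x ∈ Z := by
  rw [GradedRing.proj_apply]; exact hZ i hx

theorem pj_sum (x : R) : ∃ s : Finset ℕ, x = ∑ i ∈ s, GradedRing.proj 𝒜 i x := by
  classical
  exact ⟨_, by simpa only [GradedRing.proj_apply] using (DirectSum.sum_support_decompose 𝒜 x).symm⟩

theorem mem_of_pj {Z : Submodule k R} {x : R} (h : ∀ i, GradedRing.proj 𝒜 i x ∈ Z) : x ∈ Z := by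
  obtain ⟨s, hs⟩ := pj_sum 𝒜 x
  rw [hs]; exact Submodule.sum_mem _ fun i _ => h i

theorem mem_of_pj' {Z : Ideal R} {x : R} (h : ∀ i, GradedRing.proj 𝒜 i x ∈ Z) : x ∈ Z := by
  obtain ⟨s, hs⟩ := pj_sum 𝒜 x
  rw [hs]; exact Submodule.sum_mem _ fun i _ => h i

theorem irrel_homog : (irrel 𝒜).IsHomogeneous 𝒜 :=
  Ideal.homogeneous_span 𝒜 _ fun x ⟨i, _, h⟩ => ⟨i, h⟩

theorem mem_irrel_iff (x : R) : x ∈ irrel 𝒜 ↔ GradedRing.proj 𝒜 0 x = 0 := by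
  constructor
  · intro hx
    have : irrel 𝒜 ≤ (HomogeneousIdeal.irrelevant 𝒜).toIdeal := by
      refine Ideal.span_le.2 ?_
      rintro y ⟨i, hi, hy⟩
      exact (HomogeneousIdeal.mem_irrelevant_iff 𝒜 y).2 (pj_ne 𝒜 hy hi.ne')
    exact (HomogeneousIdeal.mem_irrelevant_iff 𝒜 x).1 (this hx)
  · intro h
    refine mem_of_pj' 𝒜 fun i => ?_
    rcases Nat.eq_zero_or_pos i with rfl | hi
    · rw [h]; exact zero_mem _
    · exact Ideal.subset_span ⟨i, hi, pj_mem 𝒜 i x⟩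

theorem mem_irrel_of {i : ℕ} (hi : 0 < i) {x : R} (hx : x ∈ 𝒜 i) : x ∈ irrel 𝒜 :=
  Ideal.subset_span ⟨i, hi, hx⟩

theorem one_not_mem_irrel [Nontrivial R] : (1 : R) ∉ irrel 𝒜 := by
  rw [mem_irrel_iff, pj_same 𝒜 (SetLike.GradedOne.one_mem)]; exact one_ne_zero

theorem exists_cst (h0 : ZeroPieceIsBase 𝒜) (x : R) : ∃ c : k, x - c • (1 : R) ∈ irrel 𝒜 := by
  obtain ⟨c, hc⟩ := h0 _ (pj_mem 𝒜 0 x)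
  refine ⟨c, ?_⟩
  rw [mem_irrel_iff, hc, map_sub, pj_same 𝒜 (pj_mem 𝒜 0 x), sub_self]

theorem irrel_max [Nontrivial R] (h0 : ZeroPieceIsBase 𝒜) : (irrel 𝒜).IsMaximal := by
  rw [Ideal.isMaximal_iff]
  refine ⟨one_not_mem_irrel 𝒜, fun K x hK hx hxK => ?_⟩
  obtain ⟨c, hc⟩ := exists_cst 𝒜 h0 x
  have hc0 : c ≠ 0 := by rintro rfl; apply hx; simpa using hc
  have : c • (1 : R) ∈ K := by simpa using K.sub_mem hxK (hK hc)
  have h2 := K.mul_mem_left (c⁻¹ • (1:R)) this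
  simpa [hc0, smul_smul] using h2

theorem fin_piece [IsNoetherianRing R] (h0 : ZeroPieceIsBase 𝒜) (n : ℕ) :
    Module.Finite k (𝒜 n) := by
  obtain ⟨T, hT, hspan⟩ := (Submodule.fg_span_iff_fg_span_finset_subset
    {x : R | ∃ i, 0 < i ∧ x ∈ 𝒜 i}).1 ((isNoetherianRing_iff_ideal_fg R).1 inferInstance (irrel 𝒜))
  have key : ∀ n, (𝒜 n).FG := by
    intro n
    induction n using Nat.strong_induction_on with
    | _ n ih =>
    rcases Nat.eq_zero_or_pos n with rfl | hn
    · refine ⟨{1}, le_antisymm ?_ ?_⟩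
      · rw [Submodule.span_le]; simpa using (SetLike.GradedOne.one_mem (A := 𝒜))
      · intro x hx
        obtain ⟨c, rfl⟩ := h0 x hx
        exact Submodule.smul_mem _ _ (Submodule.subset_span (by simp))
    · have hT' : ∀ x ∈ T, ∃ i, 0 < i ∧ x ∈ 𝒜 i := fun x hx => hT hx
      choose! d hd0 hd using hT'
      let W : Submodule k R := ⨆ t : T, if d (t : R) ≤ n then
        (𝒜 (n - d (t : R))).map (LinearMap.mulRight k (t : R)) else ⊥
      have hW : W.FG := by
        refine Submodule.fg_iSup _ fun t => ?_
        split_ifs with h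
        · exact (ih _ (by have := hd0 t t.2; omega)).map _
        · exact Submodule.fg_bot
      have hWle : W ≤ 𝒜 n := by
        refine iSup_le fun t => ?_
        split_ifs with h
        · rintro _ ⟨y, hy, rfl⟩
          have := SetLike.GradedMul.mul_mem hy (hd t t.2)
          rwa [Nat.sub_add_cancel h] at this
        · exact bot_le
      have : 𝒜 n = W := by
        refine le_antisymm ?_ hWle
        intro x hx
        have hx' : x ∈ Submodule.span R (T : Set R) := by
          rw [← hspan]; exact mem_irrel_of 𝒜 hn hx
        obtain ⟨f, -, hf⟩ := Submodule.mem_span_finset.1 hx'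
        rw [← pj_same 𝒜 hx, ← hf, map_sum]
        refine Submodule.sum_mem _ fun t ht => ?_
        rw [smul_eq_mul, pj_mul 𝒜 _ (hd t ht)]
        refine Submodule.mem_iSup_of_mem (⟨t, ht⟩ : T) ?_
        dsimp only
        split_ifs with h
        · exact ⟨_, pj_mem 𝒜 _ _, rfl⟩
        · exact zero_mem _
      rw [this]; exact hW
  exact Module.Finite.iff_fg.2 (key n)


/-- homogeneous lift -/
theorem homog_div {Z : Ideal R} (hZ : Z.IsHomogeneous 𝒜) {z x : R} {e n : ℕ} (hz : z ∈ 𝒜 e)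
    (hx : x ∈ 𝒜 n) (h : x ∈ Z ⊔ Ideal.span {z}) :
    ∃ a, x - a * z ∈ Z ∧ ((∃ i, i + e = n ∧ a ∈ 𝒜 i) ∨ a = 0) := by
  obtain ⟨y, hy, w, hw, rfl⟩ := Submodule.mem_sup.1 h
  obtain ⟨b, rfl⟩ := Ideal.mem_span_singleton'.1 hw
  have h1 := pj_homog 𝒜 hZ hy n
  have h2 : GradedRing.proj 𝒜 n y = (y + b * z) - GradedRing.proj 𝒜 n (b * z) := by
    conv_rhs => rw [← pj_same 𝒜 hx]
    rw [map_add]; ring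
  rw [h2, pj_mul 𝒜 _ hz] at h1
  split_ifs at h1 with h3
  · exact ⟨_, h1, Or.inl ⟨n - e, by omega, pj_mem 𝒜 _ _⟩⟩
  · exact ⟨0, by simpa using h1, Or.inr rfl⟩

theorem sup_span_homog {Z : Ideal R} (hZ : Z.IsHomogeneous 𝒜) {z : R} {e : ℕ} (hz : z ∈ 𝒜 e) :
    (Z ⊔ Ideal.span {z}).IsHomogeneous 𝒜 :=
  hZ.sup (Ideal.homogeneous_span 𝒜 _ (by rintro _ rfl; exact ⟨e, hz⟩))

theorem ofList_homog (l : List R) (h : ∀ x ∈ l, ∃ i, x ∈ 𝒜 i) : (Ideal.ofList l).IsHomogeneous 𝒜 :=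
  Ideal.homogeneous_span 𝒜 _ (fun x hx => h x hx)

end P5a

end PartP5a

section PartP5b
open Finset CategoryTheory

set_option linter.unusedSectionVars false
set_option linter.unusedVariables false
section P5b

def RegMod {R : Type} [CommRing R] (z : R) (Z : Ideal R) : Prop := ∀ c, z * c ∈ Z → c ∈ Z

def RS {R : Type} [CommRing R] : Ideal R → List R → Prop
  | _, [] => True
  | Z, (x :: xs) => RegMod x Z ∧ RS (Z ⊔ Ideal.span {x}) xs

def Gor {k R : Type} [Field k] [CommRing R] [Algebra k R] (𝒜 : ℕ → Submodule k R)
    (Y : Ideal R) (δ : ℕ) (u : R) : Prop :=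
  u ∈ 𝒜 δ ∧ u ∉ Y ∧ ∀ n, ∀ x ∈ 𝒜 n, x ∉ Y → ∃ m, m + n = δ ∧ ∃ r ∈ 𝒜 m, r * x - u ∈ Y

variable {k R : Type} [Field k] [CommRing R] [Algebra k R] (𝒜 : ℕ → Submodule k R) [GradedAlgebra 𝒜]

theorem RS_index (xs : List R) : ∀ Z : Ideal R,
    RS Z xs ↔ ∀ i (h : i < xs.length), RegMod xs[i] (Z ⊔ Ideal.ofList (xs.take i)) := by
  induction xs with
  | nil => intro Z; simp [RS]
  | cons x xs ih =>
    intro Z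
    simp only [RS, ih]
    constructor
    · rintro ⟨h1, h2⟩ i hi
      cases i with
      | zero => simpa using h1
      | succ i =>
        have := h2 i (by simpa using hi)
        simpa [Ideal.ofList_cons, sup_assoc] using this
    · intro h
      refine ⟨by have := h 0 (by simp); rw [List.take_zero, Ideal.ofList_nil, sup_bot_eq] at this; exact this, fun i hi => ?_⟩
      have := h (i+1) (by simpa using hi)
      simpa [Ideal.ofList_cons, sup_assoc] using this

theorem isSMulRegular_iff (r : R) (I : Ideal R) :
    IsSMulRegular (R ⧸ (I • ⊤ : Submodule R R)) r ↔ RegMod r I := by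
  rw [isSMulRegular_iff_right_eq_zero_of_smul]
  have hI : (I • ⊤ : Submodule R R) = I := by simp
  constructor
  · intro h c hc
    have := h (Submodule.Quotient.mk c) (by
      rw [← Submodule.Quotient.mk_smul, Submodule.Quotient.mk_eq_zero, hI]; exact hc)
    rwa [Submodule.Quotient.mk_eq_zero, hI] at this
  · intro h m
    obtain ⟨c, rfl⟩ := Submodule.Quotient.mk_surjective _ m
    rw [← Submodule.Quotient.mk_smul, Submodule.Quotient.mk_eq_zero, Submodule.Quotient.mk_eq_zero, hI]
    exact h c

theorem RS_iff (xs : List R) : RS ⊥ xs ↔ RingTheory.Sequence.IsWeaklyRegular R xs := by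
  rw [RS_index, RingTheory.Sequence.isWeaklyRegular_iff]
  refine forall₂_congr fun i hi => ?_
  rw [isSMulRegular_iff, bot_sup_eq]

theorem RS_append_singleton (l : List R) (z : R) : ∀ Z : Ideal R,
    RS Z (l ++ [z]) ↔ RS Z l ∧ RegMod z (Z ⊔ Ideal.ofList l) := by
  induction l with
  | nil => intro Z; simp [RS]
  | cons x xs ih =>
    intro Z
    simp only [List.cons_append, RS, ih, Ideal.ofList_cons, sup_assoc, and_assoc]

theorem RegMod_pow {z : R} {Z : Ideal R} (h : RegMod z Z) (N : ℕ) : RegMod (z ^ N) Z := by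
  induction N with
  | zero => intro c; simp
  | succ N ih => intro c hc; rw [pow_succ, mul_assoc] at hc; exact h _ (ih _ hc)

theorem swap_reg {Z : Ideal R} (hZ : Z.IsHomogeneous 𝒜) {a b : R} {d e : ℕ} (hd : 0 < d)
    (ha : a ∈ 𝒜 d) (hb : b ∈ 𝒜 e) (h1 : RegMod a Z) (h2 : RegMod b (Z ⊔ Ideal.span {a})) :
    RegMod b Z ∧ RegMod a (Z ⊔ Ideal.span {b}) := by
  constructor
  · have key : ∀ n, ∀ c ∈ 𝒜 n, b * c ∈ Z → c ∈ Z := by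
      intro n
      induction n using Nat.strong_induction_on with
      | _ n ih =>
      intro c hc hbc
      obtain ⟨a', h3, h4⟩ := homog_div 𝒜 hZ ha hc (h2 c (Ideal.mem_sup_left hbc))
      rcases h4 with ⟨i, hi, ha'⟩ | rfl
      · have : a * (b * a') ∈ Z := by
          have := Z.sub_mem hbc (Z.mul_mem_left b h3)
          convert this using 1; ring
        have h5 := ih i (by omega) a' ha' (h1 _ this)
        have := Z.add_mem h3 (Z.mul_mem_right a h5)
        simpa using this
      · simpa using h3
    intro c hc
    refine mem_of_pj' 𝒜 fun n => key n _ (pj_mem 𝒜 n c) ?_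
    have := pj_homog 𝒜 hZ hc (n + e)
    rw [mul_comm, pj_mul 𝒜 _ hb] at this
    simpa [mul_comm] using this
  · intro c hc
    obtain ⟨w, hw, v, hv, hwv⟩ := Submodule.mem_sup.1 hc
    obtain ⟨y, rfl⟩ := Ideal.mem_span_singleton'.1 hv
    have h3 : y ∈ Z ⊔ Ideal.span {a} := by
      apply h2
      have : b * y = c * a - w := by rw [mul_comm c a, ← hwv]; ring
      rw [this]
      exact Ideal.sub_mem _ (Ideal.mul_mem_left _ _ (Ideal.mem_sup_right (Ideal.mem_span_singleton_self a)))
        (Ideal.mem_sup_left hw)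
    obtain ⟨w', hw', v', hv', rfl⟩ := Submodule.mem_sup.1 h3
    obtain ⟨y', rfl⟩ := Ideal.mem_span_singleton'.1 hv'
    have h4 : c - y' * b ∈ Z := by
      apply h1
      have : a * (c - y' * b) = w + w' * b := by linear_combination -hwv
      rw [this]; exact Z.add_mem hw (Z.mul_mem_right _ hw')
    have : c = (c - y' * b) + y' * b := by ring
    rw [this]
    exact Ideal.add_mem _ (Ideal.mem_sup_left h4)
      (Ideal.mul_mem_left _ _ (Ideal.mem_sup_right (Ideal.mem_span_singleton_self b)))

theorem rot1 {x : R} {d : ℕ} (hd : 0 < d) (hx : x ∈ 𝒜 d) (xs : List R)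
    (hxs : ∀ y ∈ xs, ∃ i, y ∈ 𝒜 i) : ∀ Z : Ideal R, Z.IsHomogeneous 𝒜 → RS Z (x :: xs) →
    RS Z (xs ++ [x]) := by
  induction xs with
  | nil => intro Z _ h; exact h
  | cons y ys ih =>
    intro Z hZ h
    obtain ⟨h1, h2, h3⟩ := h
    obtain ⟨e, hy⟩ := hxs y (by simp)
    obtain ⟨h4, h5⟩ := swap_reg 𝒜 hZ hd hx hy h1 h2
    refine ⟨h4, ih (fun y hy => hxs y (by simp [hy])) _ (sup_span_homog 𝒜 hZ hy) ⟨h5, ?_⟩⟩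
    rwa [sup_assoc, sup_comm (Ideal.span {y}), ← sup_assoc]

theorem pow_dec {Z : Ideal R} (hZ : Z.IsHomogeneous 𝒜) {z : R} {e : ℕ} (hz : z ∈ 𝒜 e) (M : ℕ) :
    ∀ n, ∀ x ∈ 𝒜 n, x ∉ Z ⊔ Ideal.span {z ^ (M+1)} →
    ∃ j ≤ M, ∃ i, i + j * e = n ∧ ∃ a ∈ 𝒜 i, x - a * z ^ j ∈ Z ∧ a ∉ Z ⊔ Ideal.span {z} := by
  induction M with
  | zero => intro n x hx h; exact ⟨0, le_rfl, n, by simp, x, hx, by simp, by simpa using h⟩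
  | succ M ih =>
    intro n x hx h
    by_cases hxz : x ∈ Z ⊔ Ideal.span {z}
    · obtain ⟨a, h1, h2⟩ := homog_div 𝒜 hZ hz hx hxz
      rcases h2 with ⟨i, hi, ha⟩ | rfl
      · obtain ⟨j, hj, i', hi', a', ha', h3, h4⟩ := ih i a ha (by
          intro h3
          apply h
          obtain ⟨w, hw, v, hv, rfl⟩ := Submodule.mem_sup.1 h3
          obtain ⟨y, rfl⟩ := Ideal.mem_span_singleton'.1 hv
          have : x = (x - (w + y * z ^ (M+1)) * z + w * z) + y * z ^ (M+1+1) := by ring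
          rw [this]
          exact Ideal.add_mem _ (Ideal.mem_sup_left (Z.add_mem h1 (Z.mul_mem_right _ hw)))
            (Ideal.mul_mem_left _ _ (Ideal.mem_sup_right (Ideal.mem_span_singleton_self _))))
        refine ⟨j+1, by omega, i', by rw [← hi, ← hi']; ring, a', ha', ?_, h4⟩
        have := Z.add_mem h1 (Z.mul_mem_right z h3)
        convert this using 1; ring
      · exact absurd (Ideal.mem_sup_left (by simpa using h1)) h
    · exact ⟨0, by omega, n, by simp, x, hx, by simp, hxz⟩

theorem Gor_pow {Z : Ideal R} (hZ : Z.IsHomogeneous 𝒜) {z : R} {e : ℕ} (hz : z ∈ 𝒜 e)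
    (hr : RegMod z Z) {δ : ℕ} {u : R} (hG : Gor 𝒜 (Z ⊔ Ideal.span {z}) δ u) (M : ℕ) :
    Gor 𝒜 (Z ⊔ Ideal.span {z ^ (M+1)}) (δ + M * e) (u * z ^ M) := by
  obtain ⟨hu, hu', hG⟩ := hG
  have hzp : ∀ j, z ^ j ∈ 𝒜 (j * e) := fun j => by simpa using SetLike.pow_mem_graded j hz
  refine ⟨SetLike.GradedMul.mul_mem hu (hzp M), ?_, ?_⟩
  · intro h
    apply hu'
    obtain ⟨w, hw, v, hv, hwv⟩ := Submodule.mem_sup.1 h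
    obtain ⟨y, rfl⟩ := Ideal.mem_span_singleton'.1 hv
    have : u - y * z ∈ Z := by
      apply RegMod_pow hr M
      have : z ^ M * (u - y * z) = w := by linear_combination -hwv
      rwa [this]
    have h2 : u = (u - y * z) + y * z := by ring
    rw [h2]
    exact Ideal.add_mem _ (Ideal.mem_sup_left this)
      (Ideal.mul_mem_left _ _ (Ideal.mem_sup_right (Ideal.mem_span_singleton_self _)))
  · intro n x hx hxn
    obtain ⟨j, hj, i, hi, a, ha, h3, h4⟩ := pow_dec 𝒜 hZ hz M n x hx hxn
    obtain ⟨m, hm, r, hr, h5⟩ := hG i a ha h4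
    obtain ⟨l, rfl⟩ := Nat.exists_eq_add_of_le hj
    refine ⟨m + l * e, by rw [← hi, ← hm]; ring, r * z ^ l, SetLike.GradedMul.mul_mem hr (hzp l), ?_⟩
    obtain ⟨w, hw, v, hv, hwv⟩ := Submodule.mem_sup.1 h5
    obtain ⟨y, rfl⟩ := Ideal.mem_span_singleton'.1 hv
    have : r * z ^ l * x - u * z ^ (j + l) =
        (r * z ^ l * (x - a * z ^ j) + z ^ (j+l) * w) + y * z ^ (j+l+1) := by
      linear_combination (-z^(j+l)) * hwv
    rw [this]
    exact Ideal.add_mem _ (Ideal.mem_sup_left (Z.add_mem (Z.mul_mem_left _ h3) (Z.mul_mem_left _ hw)))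
            (Ideal.mul_mem_left _ _ (Ideal.mem_sup_right (Ideal.mem_span_singleton_self _)))

theorem rotate (M : ℕ) (dg : R → ℕ) (l : List R) : ∀ (l2 : List R) (δ : ℕ) (u : R),
    (∀ x ∈ l, 0 < dg x ∧ x ∈ 𝒜 (dg x)) → (∀ x ∈ l2, ∃ i, x ∈ 𝒜 i) →
    RS ⊥ (l ++ l2) → Gor 𝒜 (Ideal.ofList (l ++ l2)) δ u →
    RS ⊥ (l2 ++ l.map (· ^ (M+1))) ∧
    ∃ u', Gor 𝒜 (Ideal.ofList (l2 ++ l.map (· ^ (M+1)))) (δ + M * (l.map dg).sum) u' := by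
  induction l with
  | nil => intro l2 δ u _ _ h1 h2; exact ⟨by simpa using h1, u, by simpa using h2⟩
  | cons x l ih =>
    intro l2 δ u hl hl2 h1 h2
    obtain ⟨hx0, hx⟩ := hl x (by simp)
    have hll : ∀ y ∈ l ++ l2, ∃ i, y ∈ 𝒜 i := by
      intro y hy
      rcases List.mem_append.1 hy with h | h
      · exact ⟨_, (hl y (by simp [h])).2⟩
      · exact hl2 y h
    have h3 := rot1 𝒜 hx0 hx (l ++ l2) hll ⊥ (Ideal.IsHomogeneous.bot 𝒜) h1
    rw [RS_append_singleton, bot_sup_eq] at h3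
    have h4 := Gor_pow 𝒜 (ofList_homog 𝒜 _ hll) hx h3.2 (δ := δ) (u := u) (by
      rw [List.cons_append, Ideal.ofList_cons, sup_comm] at h2; exact h2) M
    have h5 : RS ⊥ (l ++ (l2 ++ [x ^ (M+1)])) := by
      rw [← List.append_assoc, RS_append_singleton, bot_sup_eq]
      exact ⟨h3.1, RegMod_pow h3.2 _⟩
    have h6 : Ideal.ofList (l ++ l2) ⊔ Ideal.span {x ^ (M+1)} = Ideal.ofList (l ++ (l2 ++ [x ^ (M+1)])) := by
      simp [Ideal.ofList_append, sup_assoc]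
    rw [h6] at h4
    obtain ⟨h7, u', h8⟩ := ih (l2 ++ [x ^ (M+1)]) _ _ (fun y hy => hl y (by simp [hy])) (by
      intro y hy
      rcases List.mem_append.1 hy with h | h
      · exact hl2 y h
      · rw [List.mem_singleton.1 h]; exact ⟨_, SetLike.pow_mem_graded (M+1) hx⟩) h5 h4
    refine ⟨by simpa using h7, u', ?_⟩
    have e1 : δ + M * ((x :: l).map dg).sum = δ + M * dg x + M * (l.map dg).sum := by
      simp; ring
    rw [e1]
    simpa using h8

theorem Gor_of_soc [IsNoetherianRing R] (h0 : ZeroPieceIsBase 𝒜) {Y : Ideal R}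
    (hrad : Y.radical = irrel 𝒜) {δ : ℕ} (h1 : socCount 𝒜 Y δ = 1)
    (h2 : ∀ n, n ≠ δ → socCount 𝒜 Y n = 0) : ∃ u, Gor 𝒜 Y δ u := by
  have hfin := fin_piece 𝒜 h0
  have hmem : ∀ x, x ∈ Y.colon (irrel 𝒜) ↔ ∀ t ∈ irrel 𝒜, t * x ∈ Y := by
    intro x
    rw [Submodule.mem_colon]
    simp only [smul_eq_mul, mul_comm x]; rfl
  set S : ℕ → Submodule k R := fun n => Submodule.restrictScalars k (Y.colon (irrel 𝒜)) ⊓ 𝒜 n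
  set Q : ℕ → Submodule k R := fun n => Submodule.restrictScalars k Y ⊓ 𝒜 n
  have hQS : ∀ n, Q n ≤ S n := fun n x hx =>
    ⟨(hmem x).2 fun t _ => Y.mul_mem_left t hx.1, hx.2⟩
  have hSfin : ∀ n, Module.Finite k (S n) := fun n =>
    Submodule.finiteDimensional_of_le (inf_le_right : S n ≤ 𝒜 n)
  have hs : ∀ n, socCount 𝒜 Y n = Module.finrank k (S n) - Module.finrank k (Q n) := fun n => rfl
  have hA : ∀ n, n ≠ δ → S n = Q n := fun n hn => by
    refine (Submodule.eq_of_le_of_finrank_le (hQS n) ?_).symm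
    have := h2 n hn
    rw [hs] at this; omega
  obtain ⟨u, huS, huQ⟩ : ∃ u, u ∈ S δ ∧ u ∉ Q δ := by
    by_contra hcon
    push Not at hcon
    have : S δ = Q δ := le_antisymm hcon (hQS δ)
    rw [hs, this] at h1; omega
  have hB : ∀ x ∈ S δ, ∃ c : k, x - c • u ∈ Q δ := by
    have hle : Q δ ⊔ Submodule.span k {u} ≤ S δ :=
      sup_le (hQS δ) (by rw [Submodule.span_singleton_le_iff_mem]; exact huS)
    have hlt : Q δ < Q δ ⊔ Submodule.span k {u} := by
      refine lt_of_le_of_ne le_sup_left fun h => huQ ?_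
      rw [h]; exact Submodule.mem_sup_right (Submodule.mem_span_singleton_self u)
    have hf2 : Module.Finite k (Q δ ⊔ Submodule.span k {u} : Submodule k R) :=
      Submodule.finiteDimensional_of_le hle
    have := Submodule.finrank_lt_finrank_of_lt hlt
    have heq := Submodule.eq_of_le_of_finrank_le hle (by rw [hs] at h1; omega)
    intro x hx
    rw [← heq] at hx
    obtain ⟨y, hy, w, hw, rfl⟩ := Submodule.mem_sup.1 hx
    obtain ⟨c, rfl⟩ := Submodule.mem_span_singleton.1 hw
    exact ⟨c, by simpa using hy⟩
  have huY : u ∉ Y := fun h => huQ ⟨h, huS.2⟩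
  refine ⟨u, huS.2, huY, ?_⟩
  obtain ⟨M, hM⟩ := Ideal.exists_radical_pow_le_of_fg Y ((isNoetherianRing_iff_ideal_fg R).1 inferInstance _)
  rw [hrad] at hM
  have key : ∀ s, ∀ n, ∀ x ∈ 𝒜 n, x ∉ Y → (∀ t ∈ irrel 𝒜 ^ s, t * x ∈ Y) →
      ∃ m, m + n = δ ∧ ∃ r ∈ 𝒜 m, r * x - u ∈ Y := by
    intro s
    induction s with
    | zero => intro n x hx hxY h; exact absurd (by simpa using h 1 (by simp)) hxY
    | succ s ih =>
      intro n x hx hxY h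
      by_cases hall : ∀ i, 0 < i → ∀ t ∈ 𝒜 i, t * x ∈ Y
      · have hxS : x ∈ S n := by
          refine ⟨(hmem x).2 fun t ht => ?_, hx⟩
          refine Submodule.span_induction ?_ ?_ ?_ ?_ ht
          · rintro t ⟨i, hi, ht⟩; exact hall i hi t ht
          · simp
          · intro a b _ _ ha hb; rw [add_mul]; exact Y.add_mem ha hb
          · intro a b _ hb; rw [smul_eq_mul, mul_assoc]; exact Y.mul_mem_left _ hb
        have hn : n = δ := by
          by_contra hn
          exact hxY (hA n hn ▸ hxS).1
        subst hn
        obtain ⟨c, hc⟩ := hB x hxS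
        have hc0 : c ≠ 0 := by rintro rfl; apply hxY; simpa using hc.1
        refine ⟨0, by simp, c⁻¹ • 1, Submodule.smul_mem _ _ SetLike.GradedOne.one_mem, ?_⟩
        have := Submodule.smul_mem (Q n) c⁻¹ hc
        have := this.1
        simpa [smul_sub, smul_smul, hc0] using this
      · push Not at hall
        obtain ⟨i, hi, t, ht, htx⟩ := hall
        obtain ⟨m, hm, r, hr, h3⟩ := ih (i + n) (t * x) (SetLike.GradedMul.mul_mem ht hx) htx (by
          intro t' ht'
          rw [← mul_assoc]
          exact h _ (by rw [pow_succ]; exact Ideal.mul_mem_mul ht' (mem_irrel_of 𝒜 hi ht)))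
        exact ⟨m + i, by omega, r * t, SetLike.GradedMul.mul_mem hr ht, by rwa [mul_assoc]⟩
  intro n x hx hxY
  exact key M n x hx hxY fun t ht => Y.mul_mem_right _ (hM ht)

end P5b

end PartP5b

section PartP5c
open Finset CategoryTheory

set_option linter.unusedSectionVars false
set_option linter.unusedVariables false
section P5c
variable {k R : Type} [Field k] [CommRing R] [Algebra k R] (𝒜 : ℕ → Submodule k R) [GradedAlgebra 𝒜]

theorem rk_null {V M : Type*} [AddCommGroup V] [Module k V] [AddCommGroup M] [Module k M]
    (W : Submodule k V) [Module.Finite k W] (f : V →ₗ[k] M) :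
    Module.finrank k (W.map f) + Module.finrank k (LinearMap.ker f ⊓ W : Submodule k V) =
      Module.finrank k W := by
  rw [← LinearMap.finrank_range_add_finrank_ker (f.domRestrict W), LinearMap.range_domRestrict]
  congr 1
  have : (LinearMap.ker f ⊓ W : Submodule k V) = (LinearMap.ker (f.domRestrict W)).map W.subtype := by
    ext x; simp [LinearMap.domRestrict_apply]
  rw [this]
  exact (LinearEquiv.finrank_eq (Submodule.equivSubtypeMap W _)).symm

theorem hilb_step (hfin : ∀ n, Module.Finite k (𝒜 n)) {Z : Ideal R} (hZ : Z.IsHomogeneous 𝒜) {z : R} {e : ℕ} (he : 0 < e)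
    (hz : z ∈ 𝒜 e) (hr : RegMod z Z) :
    hilbQ 𝒜 (Z ⊔ Ideal.span {z}) = (1 - PowerSeries.X ^ e) * hilbQ 𝒜 Z := by
  let mk : R →ₗ[k] R ⧸ (Submodule.restrictScalars k Z) := (Submodule.restrictScalars k Z).mkQ
  have hmk : LinearMap.ker mk = Submodule.restrictScalars k Z := Submodule.ker_mkQ _
  have hmk0 : ∀ x, mk x = 0 ↔ x ∈ Z := fun x => Submodule.Quotient.mk_eq_zero _
  ext n
  rw [sub_mul, one_mul, map_sub, PowerSeries.coeff_X_pow_mul']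
  simp only [hilbQ, PowerSeries.coeff_mk]
  split_ifs with hen
  · set W : Submodule k R := Submodule.restrictScalars k (Z ⊔ Ideal.span {z}) ⊓ 𝒜 n with hW
    have hWf : Module.Finite k W := Submodule.finiteDimensional_of_le (inf_le_right : W ≤ 𝒜 n)
    have h1 := rk_null W mk
    have h2 := rk_null (𝒜 (n - e)) (mk ∘ₗ LinearMap.mulRight k z)
    have e1 : LinearMap.ker mk ⊓ W = Submodule.restrictScalars k Z ⊓ 𝒜 n := by
      rw [hmk]; ext x
      constructor
      · rintro ⟨h1, h2⟩; exact ⟨h1, h2.2⟩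
      · rintro ⟨h1, h2⟩; exact ⟨h1, Ideal.mem_sup_left h1, h2⟩
    have e2 : LinearMap.ker (mk ∘ₗ LinearMap.mulRight k z) ⊓ 𝒜 (n - e) =
        Submodule.restrictScalars k Z ⊓ 𝒜 (n - e) := by
      ext x
      simp only [Submodule.mem_inf, LinearMap.mem_ker, LinearMap.comp_apply, LinearMap.mulRight_apply, hmk0,
        Submodule.restrictScalars_mem]
      refine and_congr_left fun _ => ⟨fun h => hr x (by rwa [mul_comm]), fun h => Z.mul_mem_right _ h⟩
    have e3 : W.map mk = (𝒜 (n - e)).map (mk ∘ₗ LinearMap.mulRight k z) := by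
      apply le_antisymm
      · rintro _ ⟨x, ⟨hx1, hx2⟩, rfl⟩
        obtain ⟨a, h1, h2⟩ := homog_div 𝒜 hZ hz hx2 hx1
        have ha : a ∈ 𝒜 (n - e) := by
          rcases h2 with ⟨i, hi, ha⟩ | rfl
          · rwa [← hi, Nat.add_sub_cancel]
          · exact zero_mem _
        refine ⟨a, ha, ?_⟩
        have := (hmk0 _).2 h1
        rw [map_sub, sub_eq_zero] at this
        exact this.symm
      · rintro _ ⟨x, hx, rfl⟩
        refine ⟨x * z, ⟨Ideal.mem_sup_right (Ideal.mul_mem_left _ _ (Ideal.mem_span_singleton_self z)), ?_⟩, rfl⟩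
        have := SetLike.GradedMul.mul_mem hx hz
        rwa [Nat.sub_add_cancel hen] at this
    rw [e1, e3] at h1
    rw [e2] at h2
    zify at h1 h2
    linarith
  · have : Submodule.restrictScalars k (Z ⊔ Ideal.span {z}) ⊓ 𝒜 n = Submodule.restrictScalars k Z ⊓ 𝒜 n := by
      apply le_antisymm
      · rintro x ⟨hx1, hx2⟩
        obtain ⟨a, h1, h2⟩ := homog_div 𝒜 hZ hz hx2 hx1
        rcases h2 with ⟨i, hi, ha⟩ | rfl
        · omega
        · exact ⟨by simpa using h1, hx2⟩
      · exact inf_le_inf_right _ (fun x hx => Ideal.mem_sup_left hx)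
    rw [this]; ring

theorem hilb_list (hfin : ∀ n, Module.Finite k (𝒜 n)) (dg : R → ℕ) (xs : List R) :
    ∀ Z : Ideal R, Z.IsHomogeneous 𝒜 → (∀ x ∈ xs, 0 < dg x ∧ x ∈ 𝒜 (dg x)) → RS Z xs →
    ∃ Q : Polynomial ℤ, Q ≠ 0 ∧ Q.natDegree = (xs.map dg).sum ∧
      hilbQ 𝒜 (Z ⊔ Ideal.ofList xs) = (Q : PowerSeries ℤ) * hilbQ 𝒜 Z := by
  induction xs with
  | nil => intro Z _ _ _; exact ⟨1, one_ne_zero, by simp, by simp⟩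
  | cons x xs ih =>
    intro Z hZ h hR
    obtain ⟨hx0, hx⟩ := h x (by simp)
    obtain ⟨Q, hQ0, hQ, hQh⟩ := ih _ (sup_span_homog 𝒜 hZ hx) (fun y hy => h y (by simp [hy])) hR.2
    have hdeg : (1 - Polynomial.X ^ dg x : Polynomial ℤ).natDegree = dg x := by
      have : (1 - Polynomial.X ^ dg x : Polynomial ℤ) = -(Polynomial.X ^ dg x - Polynomial.C 1) := by simp
      rw [this, Polynomial.natDegree_neg, Polynomial.natDegree_X_pow_sub_C]
    have hne : (1 - Polynomial.X ^ dg x : Polynomial ℤ) ≠ 0 := by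
      intro h; rw [h] at hdeg; simp at hdeg; omega
    refine ⟨Q * (1 - Polynomial.X ^ dg x), mul_ne_zero hQ0 hne, ?_, ?_⟩
    · rw [Polynomial.natDegree_mul hQ0 hne, hQ, hdeg]; simp [add_comm]
    · rw [Ideal.ofList_cons, ← sup_assoc, hQh, hilb_step 𝒜 hfin hZ hx0 hx hR.1]
      push_cast; ring

theorem Gor_top {Y : Ideal R} {δ : ℕ} {u : R} (hG : Gor 𝒜 Y δ u) {n : ℕ} (hn : δ < n) {x : R} (hx : x ∈ 𝒜 n) :
    x ∈ Y := by
  by_contra h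
  obtain ⟨m, hm, _⟩ := hG.2.2 n x hx h
  omega

theorem Gor_line (h0 : ZeroPieceIsBase 𝒜) {Y : Ideal R} {δ : ℕ} {u : R} (hG : Gor 𝒜 Y δ u) {x : R} (hx : x ∈ 𝒜 δ) :
    ∃ c : k, x - c • u ∈ Y := by
  by_cases h : x ∈ Y
  · exact ⟨0, by simpa using h⟩
  obtain ⟨m, hm, r, hr, h1⟩ := hG.2.2 δ x hx h
  obtain rfl : m = 0 := by omega
  obtain ⟨c, rfl⟩ := h0 r hr
  have hc : c ≠ 0 := by
    rintro rfl; apply hG.2.1; simpa using h1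
  refine ⟨c⁻¹, ?_⟩
  have := (Submodule.restrictScalars k Y).smul_mem c⁻¹ h1
  simpa [smul_sub, smul_smul, hc] using this

theorem hilb_Gor (h0 : ZeroPieceIsBase 𝒜) (hfin : ∀ n, Module.Finite k (𝒜 n)) {Y : Ideal R} {δ : ℕ} {u : R}
    (hG : Gor 𝒜 Y δ u) : ∃ P : Polynomial ℤ, P ≠ 0 ∧ P.natDegree = δ ∧ hilbQ 𝒜 Y = (P : PowerSeries ℤ) := by
  have htop : ∀ n, δ < n → PowerSeries.coeff n (hilbQ 𝒜 Y) = 0 := by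
    intro n hn
    simp only [hilbQ, PowerSeries.coeff_mk]
    rw [inf_eq_right.2 (fun x hx => Gor_top 𝒜 hG hn hx), sub_self]
  have hδ : PowerSeries.coeff δ (hilbQ 𝒜 Y) = 1 := by
    simp only [hilbQ, PowerSeries.coeff_mk]
    have h1 := rk_null (𝒜 δ) (Submodule.restrictScalars k Y).mkQ
    have e1 : (𝒜 δ).map (Submodule.restrictScalars k Y).mkQ =
        Submodule.span k {(Submodule.restrictScalars k Y).mkQ u} := by
      apply le_antisymm
      · rintro _ ⟨x, hx, rfl⟩
        obtain ⟨c, hc⟩ := Gor_line 𝒜 h0 hG hx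
        rw [Submodule.mem_span_singleton]
        refine ⟨c, ?_⟩
        rw [← map_smul, eq_comm, ← sub_eq_zero, ← map_sub]
        exact (Submodule.Quotient.mk_eq_zero _).2 hc
      · rw [Submodule.span_singleton_le_iff_mem]
        exact ⟨u, hG.1, rfl⟩
    have hne : (Submodule.restrictScalars k Y).mkQ u ≠ 0 := fun h =>
      hG.2.1 ((Submodule.Quotient.mk_eq_zero _).1 h)
    rw [e1, finrank_span_singleton hne, Submodule.ker_mkQ] at h1
    zify at h1; linarith
  have hP : hilbQ 𝒜 Y = ((PowerSeries.trunc (δ+1) (hilbQ 𝒜 Y) : Polynomial ℤ) : PowerSeries ℤ) := by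
    ext n
    rw [Polynomial.coeff_coe, PowerSeries.coeff_trunc]
    split_ifs with h
    · rfl
    · exact htop n (by omega)
  have hco : (PowerSeries.trunc (δ+1) (hilbQ 𝒜 Y)).coeff δ = 1 := by
    rw [PowerSeries.coeff_trunc, if_pos (by omega), hδ]
  refine ⟨_, ?_, ?_, hP⟩
  · intro h; rw [h] at hco; simp at hco
  · refine le_antisymm ?_ (Polynomial.le_natDegree_of_ne_zero (by rw [hco]; exact one_ne_zero))
    have := PowerSeries.natDegree_trunc_lt (hilbQ 𝒜 Y) δ
    omega

theorem ainv_eq (h0 : ZeroPieceIsBase 𝒜) (hfin : ∀ n, Module.Finite k (𝒜 n)) (dg : R → ℕ) (xs : List R)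
    (hxs : ∀ x ∈ xs, 0 < dg x ∧ x ∈ 𝒜 (dg x)) (hR : RS ⊥ xs) {δ : ℕ} {u : R}
    (hG : Gor 𝒜 (Ideal.ofList xs) δ u) {a : ℤ} (ha : IsAInv 𝒜 (⊥ : Ideal R) a) :
    a = (δ : ℤ) - ((xs.map dg).sum : ℕ) := by
  obtain ⟨num, den, hden, heq, rfl⟩ := ha
  obtain ⟨Q, hQ0, hQ, hQh⟩ := hilb_list 𝒜 hfin dg xs ⊥ (Ideal.IsHomogeneous.bot 𝒜) hxs hR
  obtain ⟨P, hP0, hP, hPh⟩ := hilb_Gor 𝒜 h0 hfin hG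
  rw [bot_sup_eq, hPh] at hQh
  have h1 : den * P = Q * num := by
    apply Polynomial.coe_injective ℤ
    push_cast
    rw [hQh, ← heq]; ring
  have hnum : num ≠ 0 := by
    rintro rfl; rw [mul_zero] at h1; exact (mul_ne_zero hden hP0) h1
  have h2 := congrArg Polynomial.natDegree h1
  rw [Polynomial.natDegree_mul hden hP0, Polynomial.natDegree_mul hQ0 hnum, hP, hQ] at h2
  omega

end P5c

end PartP5c

section PartP5d
open Finset CategoryTheory

set_option linter.unusedSectionVars false
set_option linter.unusedVariables false
section P5d
variable {k R : Type} [Field k] [CommRing R] [Algebra k R] (𝒜 : ℕ → Submodule k R) [GradedAlgebra 𝒜]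

theorem ex_fun {V : Type*} [AddCommGroup V] [Module k V] (W : Submodule k V) {v : V} (hv : v ∉ W) :
    ∃ f : V →ₗ[k] k, (∀ w ∈ W, f w = 0) ∧ f v = 1 := by
  obtain ⟨f, h1, h2⟩ := Submodule.exists_le_ker_of_notMem hv
  refine ⟨(f v)⁻¹ • f, fun w hw => ?_, ?_⟩
  · have : f w = 0 := h2 hw
    simp [this]
  · simp [h1]

theorem REP (hfin : ∀ n, Module.Finite k (𝒜 n)) {Y : Ideal R} {δ : ℕ} {u : R} (hG : Gor 𝒜 Y δ u)
    (L : R →ₗ[k] k) (hL : ∀ y ∈ Y, L y = 0) (hLu : L u = 1) {d n : ℕ} (hdn : d + n = δ)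
    (φ : R →ₗ[k] k) (hφ : ∀ y ∈ Y, φ y = 0) :
    ∃ a ∈ 𝒜 n, ∀ w ∈ 𝒜 d, L (a * w) = φ w := by
  let B : (𝒜 n) →ₗ[k] Module.Dual k (𝒜 d) :=
    LinearMap.mk₂ k (fun a w => L ((a : R) * (w : R)))
      (by intros; simp [add_mul]) (by intros; simp) (by intros; simp [mul_add]) (by intros; simp)
  have hmem : φ.comp (𝒜 d).subtype ∈ LinearMap.range B := by
    by_contra hcon
    obtain ⟨F, hF1, hF2⟩ := ex_fun _ hcon
    obtain ⟨w, rfl⟩ := (Module.evalEquiv k (𝒜 d)).surjective F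
    have hw : φ w = 1 := by simpa using hF2
    have hwY : (w : R) ∉ Y := fun h => by rw [hφ _ h] at hw; exact zero_ne_one hw
    obtain ⟨m, hm, r, hr, hru⟩ := hG.2.2 d w w.2 hwY
    obtain rfl : m = n := by omega
    have h1 : B ⟨r, hr⟩ w = 0 := by simpa using hF1 _ ⟨⟨r, hr⟩, rfl⟩
    have h2 : L (r * w) = 0 := h1
    have h3 := hL _ hru
    rw [map_sub, h2, hLu] at h3
    simp at h3
  obtain ⟨a, ha⟩ := hmem
  exact ⟨a, a.2, fun w hw => by simpa [B] using congrArg (fun f => f ⟨w, hw⟩) ha⟩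

theorem colon_homog {I J Y : Ideal R} (hJ : J.IsHomogeneous 𝒜) (hY : Y.IsHomogeneous 𝒜)
    (hI : ∀ a, a ∈ I ↔ ∀ j ∈ J, j * a ∈ Y) : I.IsHomogeneous 𝒜 := by
  intro n a ha
  rw [← GradedRing.proj_apply, hI]
  intro j hj
  obtain ⟨s, hs⟩ := pj_sum 𝒜 j
  rw [hs, sum_mul]
  refine Ideal.sum_mem _ fun i _ => ?_
  have h1 := (hI a).1 ha _ (pj_homog 𝒜 hJ hj i)
  have h2 := pj_homog 𝒜 hY h1 (n + i)
  rw [mul_comm, pj_mul 𝒜 _ (pj_mem 𝒜 i j)] at h2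
  simpa [mul_comm] using h2

theorem double_colon (hfin : ∀ n, Module.Finite k (𝒜 n)) {I J Y : Ideal R} {δ : ℕ} {u : R}
    (hG : Gor 𝒜 Y δ u) (hJ : J.IsHomogeneous 𝒜) (hY : Y.IsHomogeneous 𝒜) (hYJ : Y ≤ J)
    (hI : ∀ a, a ∈ I ↔ ∀ j ∈ J, j * a ∈ Y) (x : R) : x ∈ J ↔ ∀ a ∈ I, a * x ∈ Y := by
  refine ⟨fun hx a ha => by rw [mul_comm]; exact (hI a).1 ha x hx, ?_⟩
  obtain ⟨L, hL, hLu⟩ := ex_fun (Submodule.restrictScalars k Y) hG.2.1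
  let K : Ideal R := Submodule.colon Y (I : Set R)
  have hK : ∀ x, x ∈ K ↔ ∀ a ∈ I, a * x ∈ Y := by
    intro x; rw [Submodule.mem_colon]; simp only [smul_eq_mul, mul_comm x]; rfl
  have hKh := colon_homog 𝒜 (colon_homog 𝒜 hJ hY hI) hY hK
  intro hx
  refine mem_of_pj' 𝒜 fun d => ?_
  have hxd := pj_homog 𝒜 hKh ((hK x).2 hx) d
  have hxm := pj_mem 𝒜 d x
  generalize GradedRing.proj 𝒜 d x = x at hxd hxm
  rw [hK] at hxd
  by_contra hxJ
  have hdδ : d ≤ δ := by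
    by_contra h; exact hxJ (hYJ (Gor_top 𝒜 hG (not_le.1 h) hxm))
  obtain ⟨n, rfl⟩ := Nat.exists_eq_add_of_le hdδ
  obtain ⟨φ, hφ, hφx⟩ := ex_fun (Submodule.restrictScalars k J) hxJ
  obtain ⟨a, ha, haφ⟩ := REP 𝒜 hfin hG L hL hLu rfl φ (fun y hy => hφ y (hYJ hy))
  have haI : a ∈ I := by
    rw [hI]
    intro j hj
    obtain ⟨s, hs⟩ := pj_sum 𝒜 j
    rw [hs, sum_mul]
    refine Ideal.sum_mem _ fun i _ => ?_
    have hji := pj_homog 𝒜 hJ hj i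
    have hjm := pj_mem 𝒜 i j
    generalize GradedRing.proj 𝒜 i j = j' at hji hjm
    by_contra hcon
    obtain ⟨m, hm, r, hr, hru⟩ := hG.2.2 _ _ (SetLike.GradedMul.mul_mem hjm ha) hcon
    have h1 : r * j' ∈ 𝒜 d := by
      have : d = m + i := by omega
      rw [this]; exact SetLike.GradedMul.mul_mem hr hjm
    have h2 := haφ _ h1
    rw [hφ _ (J.mul_mem_left r hji)] at h2
    have h3 := hL _ hru
    rw [map_sub, show r * (j' * a) = a * (r * j') by ring, h2, hLu] at h3
    simp at h3
  have := haφ x hxm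
  rw [hL _ (hxd a haI), hφx] at this
  exact zero_ne_one this

theorem min_gens [IsNoetherianRing R] (h0 : ZeroPieceIsBase 𝒜) {I Y : Ideal R}
    (hI : I.IsHomogeneous 𝒜) (hY : Y.IsHomogeneous 𝒜) (hYI : Y ≤ I) :
    ∃ (s : ℕ) (g : Fin s → R) (c : Fin s → ℕ), (∀ i, g i ∈ 𝒜 (c i)) ∧
      I = Ideal.span (Set.range g) ⊔ Y ∧
      ∀ b : Fin s → R, ∑ i, b i * g i ∈ Y → ∀ i, b i ∈ irrel 𝒜 := by
  classical
  have hex : ∃ s : ℕ, ∃ (g : Fin s → R) (c : Fin s → ℕ), (∀ i, g i ∈ 𝒜 (c i)) ∧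
      I = Ideal.span (Set.range g) ⊔ Y := by
    obtain ⟨S, hS⟩ := (Ideal.IsHomogeneous.iff_exists 𝒜 I).1 hI
    have hfg : (Submodule.span R (((↑) : SetLike.homogeneousSubmonoid 𝒜 → R) '' S)).FG := by
      have := (isNoetherianRing_iff_ideal_fg R).1 inferInstance I
      rw [hS] at this; exact this
    obtain ⟨T, hT, hspan⟩ := (Submodule.fg_span_iff_fg_span_finset_subset _).1 hfg
    have hhom : ∀ x : T, ∃ i, (x : R) ∈ 𝒜 i := by
      intro x
      obtain ⟨y, _, hy⟩ := hT x.2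
      rw [← hy]; exact y.2
    choose c hc using hhom
    refine ⟨T.card, fun i => (T.equivFin.symm i : R), fun i => c (T.equivFin.symm i), fun i => hc _, ?_⟩
    have : Set.range (fun i => (T.equivFin.symm i : R)) = (T : Set R) := by
      ext x
      constructor
      · rintro ⟨i, rfl⟩; exact (T.equivFin.symm i).2
      · intro hx; exact ⟨T.equivFin ⟨x, hx⟩, by simp⟩
    rw [this]
    have h2 : I = Ideal.span (T : Set R) := by rw [hS]; exact hspan
    rw [← h2]; exact (sup_eq_left.2 hYI).symm
  obtain ⟨g, c, hg, hIg⟩ := Nat.find_spec hex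
  refine ⟨Nat.find hex, g, c, hg, hIg, ?_⟩
  have hmin := fun m (hm : m < Nat.find hex) => Nat.find_min hex hm
  generalize Nat.find hex = s at g c hg hIg hmin
  intro b hb j
  by_contra hj
  cases s with
  | zero => exact j.elim0
  | succ s =>
    refine hmin s (by omega) ⟨fun i => g (j.succAbove i), fun i => c (j.succAbove i), fun i => hg _, ?_⟩
    set N := Ideal.span (Set.range fun i => g (j.succAbove i)) ⊔ Y with hN
    have hgi : ∀ i, i ≠ j → g i ∈ N := by
      intro i hi
      obtain ⟨i', rfl⟩ := Fin.exists_succAbove_eq hi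
      exact Ideal.mem_sup_left (Ideal.subset_span ⟨i', rfl⟩)
    have hgj : g j ∈ N := by
      have h1 := pj_homog 𝒜 hY hb (c j)
      rw [map_sum, Fin.sum_univ_succAbove _ j, pj_mul 𝒜 _ (hg j)] at h1
      simp only [le_refl, if_true, Nat.sub_self] at h1
      obtain ⟨γ, hγ⟩ := h0 _ (pj_mem 𝒜 0 (b j))
      have hγ0 : γ ≠ 0 := by
        rintro rfl; apply hj; rw [mem_irrel_iff, ← hγ, zero_smul]
      rw [← hγ] at h1
      have h2 : (γ • (1 : R)) * g j ∈ N := by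
        have h3 := Ideal.sub_mem N (Ideal.mem_sup_right h1)
          (Ideal.sum_mem N (t := univ) (f := fun i => GradedRing.proj 𝒜 (c j) (b (j.succAbove i) * g (j.succAbove i)))
            fun i _ => by
              simp only [pj_mul 𝒜 _ (hg _)]
              split_ifs
              · exact N.mul_mem_left _ (hgi _ (Fin.succAbove_ne j i))
              · exact zero_mem _)
        rwa [add_sub_cancel_right] at h3
      have h4 := N.mul_mem_left (γ⁻¹ • (1:R)) h2
      simpa [smul_smul, hγ0] using h4
    rw [hIg]
    refine le_antisymm (sup_le (Ideal.span_le.2 ?_) le_sup_right) (sup_le (Ideal.span_mono ?_ |>.trans le_sup_left) le_sup_right)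
    · rintro _ ⟨i, rfl⟩
      by_cases hi : i = j
      · rw [hi]; exact hgj
      · exact hgi i hi
    · rintro _ ⟨i, rfl⟩; exact ⟨_, rfl⟩

theorem ex_phi [Nontrivial R] (I Y : Ideal R) {σ : Type} [Fintype σ] (g : σ → R)
    (hg : I = Ideal.span (Set.range g) ⊔ Y)
    (hmin : ∀ b : σ → R, ∑ i, b i * g i ∈ Y → ∀ i, b i ∈ irrel 𝒜) (t : σ → k) :
    ∃ φ : R →ₗ[k] k, (∀ y ∈ Y, φ y = 0) ∧ (∀ m ∈ irrel 𝒜, ∀ a ∈ I, φ (m * a) = 0) ∧ ∀ i, φ (g i) = t i := by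
  classical
  let K : Submodule k R := Submodule.restrictScalars k (irrel 𝒜 * I ⊔ Y)
  let Λ : (σ → k) →ₗ[k] (R ⧸ K) := K.mkQ ∘ₗ Fintype.linearCombination k g
  have hΛ : LinearMap.ker Λ = ⊥ := by
    rw [LinearMap.ker_eq_bot']
    intro γ hγ
    have h1 : ∑ i, γ i • g i ∈ irrel 𝒜 * I ⊔ Y := by
      have : Fintype.linearCombination k g γ ∈ K := (Submodule.Quotient.mk_eq_zero _).1 hγ
      rwa [Fintype.linearCombination_apply] at this
    have h2 : irrel 𝒜 * I ⊔ Y ≤ irrel 𝒜 * Ideal.span (Set.range g) ⊔ Y := by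
      have h3 : irrel 𝒜 * Y ≤ Y := Ideal.mul_le.2 fun r _ s hs => Y.mul_mem_left r hs
      rw [hg, Ideal.mul_sup, sup_assoc, sup_eq_right.2 h3]
    obtain ⟨v, hv, y, hy, hvy⟩ := Submodule.mem_sup.1 (h2 h1)
    obtain ⟨m, hm, hmv⟩ : ∃ m : σ → R, (∀ i, m i ∈ irrel 𝒜) ∧ ∑ i, m i * g i = v := by
      rw [← smul_eq_mul, Ideal.span, Submodule.mem_ideal_smul_span_iff_exists_sum] at hv
      obtain ⟨m, hm, hmv⟩ := hv
      refine ⟨m, hm, ?_⟩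
      rw [← hmv, Finsupp.sum_fintype _ _ (by simp)]
      simp only [smul_eq_mul]
    rw [← hmv] at hvy
    have h3 : ∑ i, (γ i • (1 : R) - m i) * g i ∈ Y := by
      have : ∑ i, (γ i • (1 : R) - m i) * g i = y := by
        simp only [sub_mul, sum_sub_distrib, smul_mul_assoc, one_mul, ← hvy]; ring
      rwa [this]
    ext i
    have h4 := Ideal.add_mem _ (hmin _ h3 i) (hm i)
    rw [sub_add_cancel] at h4
    by_contra hne
    have h5 := (irrel 𝒜).mul_mem_left ((γ i)⁻¹ • (1:R)) h4
    have hne' : γ i ≠ 0 := hne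
    exact one_not_mem_irrel 𝒜 (by simpa [smul_smul, hne'] using h5)
  obtain ⟨M, hM⟩ := LinearMap.exists_leftInverse_of_injective Λ hΛ
  let φ : R →ₗ[k] k := (Fintype.linearCombination k t) ∘ₗ M ∘ₗ K.mkQ
  have hφK : ∀ x ∈ irrel 𝒜 * I ⊔ Y, φ x = 0 := by
    intro x hx
    have : K.mkQ x = 0 := (Submodule.Quotient.mk_eq_zero _).2 hx
    simp only [φ, LinearMap.comp_apply, this, map_zero]
  refine ⟨φ, fun y hy => hφK y (Ideal.mem_sup_right hy),
    fun m hm a ha => hφK _ (Ideal.mem_sup_left (Ideal.mul_mem_mul hm ha)), fun i => ?_⟩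
  have h1 : K.mkQ (g i) = Λ (Pi.single i 1) := by
    simp [Λ, Fintype.linearCombination_apply_single]
  have h2 : M (Λ (Pi.single i 1)) = Pi.single i 1 := by
    rw [← LinearMap.comp_apply, hM]; rfl
  simp only [φ, LinearMap.comp_apply]
  rw [h1, h2, Fintype.linearCombination_apply_single]; simp

theorem SOC [Nontrivial R] (h0 : ZeroPieceIsBase 𝒜) (hfin : ∀ n, Module.Finite k (𝒜 n)) {I J Y : Ideal R} {δ : ℕ} {u : R}
    (hG : Gor 𝒜 Y δ u) {σ : Type} [Fintype σ] (g : σ → R) (c : σ → ℕ) (hgc : ∀ i, g i ∈ 𝒜 (c i))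
    (hg : I = Ideal.span (Set.range g) ⊔ Y)
    (hmin : ∀ b : σ → R, ∑ i, b i * g i ∈ Y → ∀ i, b i ∈ irrel 𝒜)
    (hJ : ∀ x, x ∈ J ↔ ∀ a ∈ I, a * x ∈ Y) (d : ℕ) :
    socCount 𝒜 J d = (univ.filter fun i => c i + d = δ).card := by
  classical
  obtain ⟨L, hL, hLu⟩ := ex_fun (Submodule.restrictScalars k Y) hG.2.1
  have hYJ : Y ≤ J := fun y hy => (hJ y).2 fun a _ => Y.mul_mem_left a hy
  have hJ' : ∀ x, x ∈ J ↔ ∀ i, g i * x ∈ Y := by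
    intro x
    rw [hJ]
    constructor
    · intro h i
      exact h _ (by rw [hg]; exact Ideal.mem_sup_left (Ideal.subset_span ⟨i, rfl⟩))
    · intro h a ha
      have : I ≤ Submodule.colon Y ({x} : Set R) := by
        rw [hg]
        refine sup_le (Ideal.span_le.2 ?_) ?_
        · rintro _ ⟨i, rfl⟩; simpa using h i
        · intro y hy; simpa using Y.mul_mem_right x hy
      simpa using this ha
  have hmem : ∀ x, x ∈ J.colon (irrel 𝒜 : Set R) ↔ ∀ t ∈ irrel 𝒜, t * x ∈ J := by
    intro x
    rw [Submodule.mem_colon]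
    simp only [smul_eq_mul, mul_comm x]; rfl
  set S : Submodule k R := Submodule.restrictScalars k (J.colon (irrel 𝒜)) ⊓ 𝒜 d with hS
  set Q : Submodule k R := Submodule.restrictScalars k J ⊓ 𝒜 d with hQ
  have hsc : socCount 𝒜 J d = Module.finrank k S - Module.finrank k Q := rfl
  have hSfin : Module.Finite k S := Submodule.finiteDimensional_of_le (inf_le_right : S ≤ 𝒜 d)
  have hQS : Q ≤ S := fun x hx => ⟨(hmem x).2 fun t _ => J.mul_mem_left t hx.1, hx.2⟩
  let T := {i : σ // c i + d = δ}
  let f : R →ₗ[k] (T → k) := LinearMap.pi fun i => L ∘ₗ LinearMap.mulLeft k (g i)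
  have hf : ∀ x i, f x i = L (g i.1 * x) := fun x i => rfl
  have hker : LinearMap.ker f ⊓ S = Q := by
    apply le_antisymm
    · rintro x ⟨hx1, hx2⟩
      refine ⟨(hJ' x).2 fun i => ?_, hx2.2⟩
      by_cases hi : c i + d = δ
      · have h1 : L (g i * x) = 0 := by
          rw [← hf x ⟨i, hi⟩, LinearMap.mem_ker.1 hx1]; rfl
        have h2 : g i * x ∈ 𝒜 δ := hi ▸ SetLike.GradedMul.mul_mem (hgc i) hx2.2
        obtain ⟨γ, hγ⟩ := Gor_line 𝒜 h0 hG h2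
        have h3 := hL _ hγ
        rw [map_sub, h1, map_smul, hLu] at h3
        have : γ = 0 := by simpa using h3
        simpa [this] using hγ
      · by_contra hcon
        obtain ⟨m, hm, r, hr, hru⟩ := hG.2.2 _ _ (SetLike.GradedMul.mul_mem (hgc i) hx2.2) hcon
        have h1 := (hmem x).1 hx2.1 r (mem_irrel_of 𝒜 (by omega) hr)
        have h2 := (hJ' _).1 h1 i
        apply hG.2.1
        have := Y.sub_mem h2 hru
        convert this using 1; ring
    · intro x hx
      refine ⟨?_, hQS hx⟩
      refine LinearMap.mem_ker.2 ?_
      ext i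
      rw [hf]
      exact hL _ ((hJ' x).1 hx.1 i.1)
  have hmap : S.map f = ⊤ := by
    rw [eq_top_iff]
    intro t _
    by_cases hdδ : d ≤ δ
    · obtain ⟨n, rfl⟩ := Nat.exists_eq_add_of_le hdδ
      obtain ⟨φ, hφY, hφm, hφg⟩ := ex_phi 𝒜 I Y g hg hmin (fun i => if h : c i + d = d + n then t ⟨i, h⟩ else 0)
      obtain ⟨x, hx, hxφ⟩ := REP 𝒜 hfin hG L hL hLu (Nat.add_comm n d) φ hφY
      refine ⟨x, ⟨(hmem x).2 fun m hm => ?_, hx⟩, ?_⟩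
      · refine Submodule.span_induction ?_ ?_ ?_ ?_ hm
        · rintro m ⟨i, hi, hmi⟩
          rw [hJ']
          intro j
          by_contra hcon
          obtain ⟨l, hl, r, hr, hru⟩ := hG.2.2 _ _
            (SetLike.GradedMul.mul_mem (hgc j) (SetLike.GradedMul.mul_mem hmi hx)) hcon
          have h1 : m * (r * g j) ∈ 𝒜 n := by
            have : n = i + (l + c j) := by omega
            rw [this]
            exact SetLike.GradedMul.mul_mem hmi (SetLike.GradedMul.mul_mem hr (hgc j))
          have h2 := hxφ _ h1
          rw [hφm m (mem_irrel_of 𝒜 hi hmi) _ (I.mul_mem_left r (by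
            rw [hg]; exact Ideal.mem_sup_left (Ideal.subset_span ⟨j, rfl⟩)))] at h2
          have h3 := hL _ hru
          rw [map_sub, show r * (g j * (m * x)) = x * (m * (r * g j)) by ring, h2, hLu] at h3
          simp at h3
        · simp
        · intro a b _ _ ha hb; rw [add_mul]; exact J.add_mem ha hb
        · intro a b _ hb; rw [smul_eq_mul, mul_assoc]; exact J.mul_mem_left _ hb
      · ext i
        rw [hf, mul_comm, hxφ (g i.1) (by
          have h1 := i.2
          have : c i.1 = n := by omega
          have h2 := hgc i.1
          rw [this] at h2; exact h2), hφg, dif_pos i.2]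
    · have : IsEmpty T := ⟨fun i => hdδ (by have := i.2; omega)⟩
      exact ⟨0, zero_mem _, Subsingleton.elim _ _⟩
  have h1 := rk_null S f
  rw [hker, hmap, finrank_top, Module.finrank_fintype_fun_eq_card, Fintype.card_subtype] at h1
  rw [hsc]; omega

end P5d

end PartP5d

open Finset CategoryTheory
set_option linter.unusedVariables false

theorem count_final {ℓ s : ℕ} (d : Fin ℓ → ℕ) (c : Fin s → ℕ) (δy δ' q : ℕ) (a B : ℤ)
    (hy : (δy : ℤ) = a + B) (h' : (δ' : ℤ) = a + q * B)
    (hc : ∀ j, c j ≤ δy) (hc' : ∀ j, q * c j ≤ δ')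
    (h1 : ∀ n, (univ.filter fun i => d i = n).card = (univ.filter fun j => c j + n = δy).card) :
    (∀ i, (0 : ℤ) ≤ (q : ℤ) * d i - ((q : ℤ) - 1) * a) ∧
    ∀ n : ℕ, (univ.filter fun j => q * c j + n = δ').card =
      (univ.filter fun i => (q : ℤ) * d i - ((q : ℤ) - 1) * a = (n : ℤ)).card := by
  classical
  have hfib : ∀ n, Nonempty ({i // d i = n} ≃ {j // δy - c j = n}) := by
    intro n
    refine ⟨Fintype.equivOfCardEq ?_⟩
    rw [Fintype.card_subtype, Fintype.card_subtype, h1]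
    congr 1
    ext j
    have := hc j
    simp only [mem_filter, mem_univ, true_and]; omega
  let f := fun n => Classical.choice (hfib n)
  let e := Equiv.ofFiberEquiv f
  have he : ∀ i, δy - c (e i) = d i := fun i => Equiv.ofFiberEquiv_map f i
  have hval : ∀ i, (q : ℤ) * d i - ((q : ℤ) - 1) * a = δ' - q * c (e i) := by
    intro i
    have h2 := he i
    have h3 := hc (e i)
    have h4 : (d i : ℤ) = δy - c (e i) := by omega
    rw [h4, hy, h']; ring
  constructor
  · intro i
    rw [hval]
    have := hc' (e i)
    have : ((q * c (e i) : ℕ) : ℤ) ≤ δ' := by exact_mod_cast this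
    push_cast at this; linarith
  · intro n
    refine (Finset.card_equiv e fun i => ?_).symm
    simp only [mem_filter, mem_univ, true_and]
    rw [hval]
    constructor
    · intro h
      have : ((q * c (e i) + n : ℕ) : ℤ) = δ' := by push_cast; linarith
      exact_mod_cast this
    · intro h
      rw [← h]; push_cast; ring

theorem map_homog {k R : Type} [Field k] [CommRing R] [Algebra k R] (𝒜 : ℕ → Submodule k R) [GradedAlgebra 𝒜]
    (φ : R →+* R) (q : ℕ) (hφ : ∀ x, φ x = x ^ q) {J : Ideal R} (hJ : J.IsHomogeneous 𝒜) :
    (Ideal.map φ J).IsHomogeneous 𝒜 := by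
  obtain ⟨S, hS⟩ := (Ideal.IsHomogeneous.iff_exists 𝒜 J).1 hJ
  rw [hS, Ideal.map_span]
  refine Ideal.homogeneous_span 𝒜 _ ?_
  rintro _ ⟨_, ⟨x, _, rfl⟩, rfl⟩
  obtain ⟨i, hi⟩ := x.2
  rw [hφ]
  exact ⟨_, SetLike.pow_mem_graded q hi⟩

theorem socle_degrees_stmt2
    {k R : Type} [Field k] [CommRing R] [Algebra k R]
    (p : ℕ) [Fact p.Prime] [CharP R p]
    (𝒜 : ℕ → Submodule k R) [GradedAlgebra 𝒜] (h0 : ZeroPieceIsBase 𝒜)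
    (hFT : Algebra.FiniteType k R)
    (hGor : IsGorensteinGraded 𝒜)
    (J : Ideal R) (hJ : J.IsHomogeneous 𝒜) (hart : J.radical = irrel 𝒜)
    (e : ℕ) (q : ℕ) (hq : q = p ^ e)
    (hpd : HasFinProjDim 𝒜 (ModuleCat.of R (R ⧸ J)))
    (a : ℤ) (ha : IsAInv 𝒜 (⊥ : Ideal R) a)
    {ℓ : ℕ} (d : Fin ℓ → ℕ) (hd : HasSocleDegrees 𝒜 J d) :
    (∀ i, (0 : ℤ) ≤ (q : ℤ) * d i - ((q : ℤ) - 1) * a) ∧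
    ∀ n : ℕ, socCount 𝒜 (frobPow J q) n =
      (univ.filter fun i => (q : ℤ) * d i - ((q : ℤ) - 1) * a = (n : ℤ)).card := by
  classical
  have hp : p.Prime := Fact.out
  have : ExpChar R p := ExpChar.prime hp
  have : Nontrivial R := CharP.nontrivial_of_char_ne_one (v := p) hp.ne_one
  have : IsNoetherianRing R := Algebra.FiniteType.isNoetherianRing k R
  have hmax := irrel_max 𝒜 h0
  have hfin := fin_piece 𝒜 h0
  have hq1 : 1 ≤ q := by rw [hq]; exact Nat.one_le_pow _ _ hp.pos
  let φ : R →+* R := iterateFrobenius R p e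
  have hφ : ∀ x, φ x = x ^ q := fun x => by rw [hq]; exact iterateFrobenius_def p e x
  obtain ⟨xs, hreg, hhom, hrad, δ0, hδ1, hδ2⟩ := hGor
  choose! dg hdg using hhom
  obtain ⟨u0, hG0⟩ := Gor_of_soc 𝒜 h0 hrad hδ1 hδ2
  have hRS := (RS_iff xs).2 hreg.toIsWeaklyRegular
  have haeq := ainv_eq 𝒜 h0 hfin dg xs hdg hRS hG0 ha
  obtain ⟨M, hM⟩ := Ideal.exists_radical_pow_le_of_fg J ((isNoetherianRing_iff_ideal_fg R).1 inferInstance _)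
  rw [hart] at hM
  obtain ⟨M', hM'⟩ : ∃ M', M' + 1 = (M + 1) * q :=
    ⟨(M+1) * q - 1, Nat.sub_add_cancel (Nat.mul_pos (by omega) hq1)⟩
  have hrot := fun N => rotate 𝒜 N dg xs [] δ0 u0 hdg (by simp) (by simpa using hRS) (by simpa using hG0)
  simp only [List.nil_append] at hrot
  set y := xs.map (· ^ (M+1)) with hydef
  set y' := xs.map (· ^ (M'+1)) with hy'def
  obtain ⟨hRy, uy, hGy⟩ := hrot M
  obtain ⟨hRy', uy', hGy'⟩ := hrot M'
  rw [← hydef] at hRy hGy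
  rw [← hy'def] at hRy' hGy'
  have hyy' : y.map φ = y' := by
    rw [hydef, hy'def, List.map_map]
    refine List.map_congr_left fun x _ => ?_
    simp only [Function.comp_apply, hφ]
    rw [← pow_mul, hM']
  have hyhom : ∀ x ∈ y, ∃ i, x ∈ 𝒜 i := by
    intro x hx
    obtain ⟨z, hz, rfl⟩ := List.mem_map.1 hx
    exact ⟨_, SetLike.pow_mem_graded (M+1) (hdg z hz).2⟩
  have hY := ofList_homog 𝒜 y hyhom
  have hyJ : ∀ r ∈ y, r ∈ J := by
    intro x hx
    obtain ⟨z, hz, rfl⟩ := List.mem_map.1 hx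
    have h1 : z ^ M ∈ irrel 𝒜 ^ M := Ideal.pow_mem_pow (mem_irrel_of 𝒜 (hdg z hz).1 (hdg z hz).2) M
    show z ^ (M + 1) ∈ J
    rw [pow_succ]; exact J.mul_mem_right _ (hM h1)
  have hYJ : Ideal.ofList y ≤ J := Ideal.span_le.2 fun r hr => hyJ r hr
  have hwy := (RS_iff y).1 hRy
  have hwy' := (RS_iff y').1 hRy'
  have hsm : ∀ t ∈ irrel 𝒜, t * uy ∈ Ideal.ofList y := by
    intro t ht
    refine Submodule.span_induction ?_ ?_ ?_ ?_ ht
    · rintro t ⟨i, hi, hti⟩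
      exact Gor_top 𝒜 hGy (by omega) (SetLike.GradedMul.mul_mem hti hGy.1)
    · simp
    · intro a b _ _ ha hb; rw [add_mul]; exact Ideal.add_mem _ ha hb
    · intro a b _ hb; rw [smul_eq_mul, mul_assoc]; exact Ideal.mul_mem_left _ _ hb
  have hpd' := T1 𝒜 J hart hpd y hwy uy hGy.2.1 hsm
  let I : Ideal R := Submodule.colon (Ideal.ofList y) (J : Set R)
  have hI : ∀ a, a ∈ I ↔ ∀ j ∈ J, j * a ∈ Ideal.ofList y := by
    intro x; rw [Submodule.mem_colon]; simp only [smul_eq_mul, mul_comm x]; rfl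
  have hYI : Ideal.ofList y ≤ I := fun x hx => (hI x).2 fun j _ => Ideal.mul_mem_left _ _ hx
  obtain ⟨s, g, c, hgc, hIg, hmin⟩ := min_gens 𝒜 h0 (colon_homog 𝒜 hJ hY hI) hY hYI
  have hdc := double_colon 𝒜 hfin hGy hJ hY hYJ hI
  have hsoc := SOC 𝒜 h0 hfin hGy g c hgc hIg hmin hdc
  -- Frobenius side
  have hJ'eq : frobPow J q = Ideal.map φ J := by
    unfold frobPow Ideal.map
    congr 1
    ext x; simp [hφ]
  have hY'eq : Ideal.ofList y' = Ideal.map φ (Ideal.ofList y) := by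
    rw [Ideal.map_ofList, hyy']
  have hwB : RingTheory.Sequence.IsWeaklyRegular R (y.map φ) := by rw [hyy']; exact hwy'
  have hI' : ∀ b, b ∈ Ideal.map φ I ↔ ∀ j ∈ Ideal.map φ J, j * b ∈ Ideal.ofList y' := by
    intro b
    rw [hY'eq]
    constructor
    · intro hb j hj
      have h1 : J * I ≤ Ideal.ofList y := Ideal.mul_le.2 fun j hj i hi => (hI i).1 hi j hj
      have h2 := Ideal.map_mono (f := φ) h1
      rw [Ideal.map_mul] at h2
      exact h2 (Ideal.mul_mem_mul hj hb)
    · intro h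
      exact C1 φ J y hpd' hyJ hwy I hI hwB b fun j hj => h _ (Ideal.mem_map_of_mem φ hj)
  have hY' : (Ideal.ofList y').IsHomogeneous 𝒜 := by
    rw [hY'eq]; exact map_homog 𝒜 φ q hφ hY
  have hJ' : (Ideal.map φ J).IsHomogeneous 𝒜 := map_homog 𝒜 φ q hφ hJ
  have hYJ' : Ideal.ofList y' ≤ Ideal.map φ J := by rw [hY'eq]; exact Ideal.map_mono hYJ
  have hdc' := double_colon 𝒜 hfin hGy' hJ' hY' hYJ' hI'
  have hIg' : Ideal.map φ I = Ideal.span (Set.range fun i => φ (g i)) ⊔ Ideal.ofList y' := by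
    have h1 : Ideal.map φ I = Ideal.map φ (Ideal.span (Set.range g) ⊔ Ideal.ofList y) := congrArg _ hIg
    rw [h1, Ideal.map_sup, Ideal.map_span, hY'eq, ← Set.range_comp]; rfl
  have hmirr : Ideal.map φ (irrel 𝒜) ≤ irrel 𝒜 := by
    rw [Ideal.map_le_iff_le_comap]
    intro x hx
    rw [Ideal.mem_comap, hφ]
    exact Ideal.pow_mem_of_mem _ hx q hq1
  have hmin' : ∀ b : Fin s → R, ∑ i, b i * φ (g i) ∈ Ideal.ofList y' → ∀ i, b i ∈ irrel 𝒜 := by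
    intro b hb i
    rw [hY'eq] at hb
    exact hmirr (C2 φ J y hpd' hyJ hwy I hI hwB (irrel 𝒜) g hIg hmin b hb i)
  have hgc' : ∀ i, φ (g i) ∈ 𝒜 (q * c i) := fun i => by
    rw [hφ]; simpa using SetLike.pow_mem_graded q (hgc i)
  have hsoc' := SOC 𝒜 h0 hfin hGy' (fun i => φ (g i)) (fun i => q * c i) hgc' hIg' hmin' hdc'
  have hnot : ∀ (G : Fin s → R) (Y : Ideal R), (∀ b : Fin s → R, ∑ i, b i * G i ∈ Y → ∀ i, b i ∈ irrel 𝒜) →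
      ∀ i, G i ∉ Y := by
    intro G Y h i hi
    have := h (Pi.single i 1) (by
      rw [Finset.sum_eq_single i]
      · simpa using hi
      · intro j _ hj; simp [Pi.single_eq_of_ne hj]
      · simp) i
    rw [Pi.single_eq_same] at this
    exact one_not_mem_irrel 𝒜 this
  have hc1 : ∀ j, c j ≤ δ0 + M * (xs.map dg).sum := fun j => by
    by_contra h
    exact hnot g _ hmin j (Gor_top 𝒜 hGy (not_le.1 h) (hgc j))
  have hc2 : ∀ j, q * c j ≤ δ0 + M' * (xs.map dg).sum := fun j => by
    by_contra h
    exact hnot _ _ hmin' j (Gor_top 𝒜 hGy' (not_le.1 h) (hgc' j))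
  have hfinal := count_final d c _ _ q a ((M + 1) * (xs.map dg).sum) (by rw [haeq]; push_cast; ring)
    (by
      have : ((M' : ℤ) + 1) = (M + 1) * q := by exact_mod_cast hM'
      have hM2 : (M' : ℤ) = (M + 1) * q - 1 := by linarith
      rw [haeq]; push_cast; rw [hM2]; ring) hc1 hc2 (fun n => by rw [← hd.2 n, hsoc n])
  refine ⟨hfinal.1, fun n => ?_⟩
  rw [hJ'eq, hsoc' n]
  exact hfinal.2 n
end

section
/- Let P be a regular commutative ring of positive characteristic p, q = p^e, and let C and I be ideals of P with C generated by a regular sequence f_1, …, f_c. Set y = (f_1·f_2·⋯·f_c)^{q−1}. If (C + I)^{[q]} : y = C + I^{[q]}, then I^{[q]} ∩ C = (I ∩ C)^{[q]} + C·I^{[q]}. -/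
open Finset CategoryTheory

/-- A commutative ring is regular iff it is Noetherian and each localization at a prime is a
regular local ring (maximal ideal generated by `dim` many elements). -/
def IsRegularLocalizationAt (P : Type) [CommRing P] (q : Ideal P) [q.IsPrime] : Prop :=
  ∃ s : Finset (Localization.AtPrime q),
    Ideal.span (s : Set (Localization.AtPrime q)) =
      IsLocalRing.maximalIdeal (Localization.AtPrime q) ∧
    (s.card : WithBot (WithTop ℕ)) = ringKrullDim (Localization.AtPrime q)

def IsRegularCommRing (P : Type) [CommRing P] : Prop :=
  IsNoetherianRing P ∧ ∀ (q : Ideal P) (hq : q.IsPrime), @IsRegularLocalizationAt P _ q hq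


def syzSpan {R : Type} [CommRing R] (J : Ideal R) (φ : R →+* R) {ι : Type} [Fintype ι]
    (a : ι → R) : Submodule R (ι → R) :=
  Submodule.span R {v | ∃ b : ι → R, ∑ i, b i * a i ∈ J ∧ v = fun i => φ (b i)}

def RelProp {R : Type} [CommRing R] (φ : R →+* R) : Prop :=
  ∀ (ι : Type) [Fintype ι] (a s : ι → R), ∑ i, s i * φ (a i) = 0 → s ∈ syzSpan ⊥ φ a

def RelMod {R : Type} [CommRing R] (x : R) (φ : R →+* R) (k : ℕ) : Prop :=
  ∀ (ι : Type) [Fintype ι] (a s : ι → R), ∑ i, s i * φ (a i) ∈ Ideal.span {x ^ k} →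
    ∃ w u : ι → R, w ∈ syzSpan (Ideal.span {x}) φ a ∧ s = w + x ^ k • u

theorem relMod_one {R : Type} [CommRing R] (x : R) (φ : R →+* R)
    (ψ : R ⧸ Ideal.span {x} →+* R ⧸ Ideal.span {x})
    (hψ : ∀ r, ψ (Ideal.Quotient.mk _ r) = Ideal.Quotient.mk _ (φ r)) (h : RelProp ψ) :
    RelMod x φ 1 := by
  intro ι _ a s hs
  rw [pow_one] at *
  have h1 := h ι (fun i => Ideal.Quotient.mk _ (a i)) (fun i => Ideal.Quotient.mk _ (s i)) (by
    simp only [hψ, ← map_mul, ← map_sum]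
    exact Ideal.Quotient.eq_zero_iff_mem.2 hs)
  obtain ⟨n, t, g, hg⟩ := Submodule.mem_span_set'.1 h1
  have hgb := fun k => (g k).2
  choose b hb hb' using hgb
  choose t' ht' using fun k => Ideal.Quotient.mk_surjective (t k)
  choose b' hbb using fun k i => Ideal.Quotient.mk_surjective (b k i)
  have h2 : ∀ i, ∃ u, s i - ∑ k, t' k * φ (b' k i) = x * u := by
    intro i
    have : s i - ∑ k, t' k * φ (b' k i) ∈ Ideal.span {x} := by
      rw [← Ideal.Quotient.eq_zero_iff_mem, map_sub, map_sum, sub_eq_zero]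
      have := congrFun hg i
      simp only [Finset.sum_apply, Pi.smul_apply, smul_eq_mul, hb'] at this
      rw [← this]
      refine Finset.sum_congr rfl fun k _ => ?_
      rw [map_mul, ht', ← hψ, hbb]
    obtain ⟨u, hu⟩ := Ideal.mem_span_singleton'.1 this
    exact ⟨u, by rw [← hu, mul_comm]⟩
  choose u hu using h2
  refine ⟨∑ k, t' k • fun i => φ (b' k i), u, ?_, ?_⟩
  · refine Submodule.sum_mem _ fun k _ => Submodule.smul_mem _ _ (Submodule.subset_span ⟨b' k, ?_, rfl⟩)
    rw [← Ideal.Quotient.eq_zero_iff_mem, map_sum]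
    have := hb k
    simp only [Ideal.mem_bot] at this
    rw [← this]
    refine Finset.sum_congr rfl fun i _ => ?_
    rw [map_mul, hbb]
  · ext i
    simp only [Pi.add_apply, Finset.sum_apply, Pi.smul_apply, smul_eq_mul]
    rw [← hu]; ring

theorem syz_eval {R : Type} [CommRing R] (x : R) (φ : R →+* R) {ι : Type} [Fintype ι]
    (a w : ι → R) (hw : w ∈ syzSpan (Ideal.span {x}) φ a) :
    ∃ (n : ℕ) (t : Fin n → R) (b : Fin n → ι → R) (c : Fin n → R),
      (∀ k, ∑ i, b k i * a i = x * c k) ∧ (∀ i, w i = ∑ k, t k * φ (b k i)) ∧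
      ∑ i, w i * φ (a i) = φ x * ∑ k, t k * φ (c k) := by
  obtain ⟨n, t, g, hg⟩ := Submodule.mem_span_set'.1 hw
  have hgb := fun k => (g k).2
  choose b hb hb' using hgb
  choose c hc using fun k => Ideal.mem_span_singleton'.1 (hb k)
  have hw' : ∀ i, w i = ∑ k, t k * φ (b k i) := by
    intro i
    rw [← hg]
    simp only [Finset.sum_apply, Pi.smul_apply, smul_eq_mul, hb']
  refine ⟨n, t, b, c, fun k => by rw [← hc, mul_comm], hw', ?_⟩
  simp only [hw', Finset.sum_mul]
  rw [Finset.sum_comm, Finset.mul_sum]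
  refine Finset.sum_congr rfl fun k _ => ?_
  have : φ x * φ (c k) = ∑ i, φ (b k i) * φ (a i) := by
    rw [← map_mul, mul_comm, hc k, map_sum]; simp only [map_mul]
  rw [mul_left_comm, this, Finset.mul_sum]
  simp only [mul_assoc]

theorem relMod_k {R : Type} [CommRing R] (x : R) (hx : x ∈ nonZeroDivisors R) (φ : R →+* R) (q : ℕ)
    (hφ : φ x = x ^ q) (h : RelMod x φ 1) : ∀ k, k ≤ q → RelMod x φ k := by
  intro k
  induction k with
  | zero =>
    intro _ ι _ a s _
    exact ⟨0, s, Submodule.zero_mem _, by simp⟩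
  | succ k ih =>
    intro hk ι _ a s hs
    obtain ⟨w, u, hw, rfl⟩ := ih (by omega) ι a s
      (Ideal.span_singleton_le_span_singleton.2 (pow_dvd_pow x (Nat.le_succ k)) hs)
    obtain ⟨n, t, b, c, hb, hwb, hwe⟩ := syz_eval x φ a w hw
    simp only [Pi.add_apply, Pi.smul_apply, smul_eq_mul, add_mul, Finset.sum_add_distrib, hwe, hφ] at hs
    obtain ⟨v, hv⟩ := Ideal.mem_span_singleton'.1 hs
    have h1 : ∑ i, u i * φ (a i) ∈ Ideal.span {x ^ 1} := by
      obtain ⟨j, rfl⟩ := Nat.exists_eq_add_of_le hk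
      refine Ideal.mem_span_singleton'.2 ⟨v - x ^ j * ∑ k, t k * φ (c k), ?_⟩
      have hxk : x ^ k ∈ nonZeroDivisors R := pow_mem hx k
      rw [← sub_eq_zero]
      apply (mem_nonZeroDivisors_iff.1 hxk).1
      have : ∑ i, x ^ k * u i * φ (a i) = x ^ k * ∑ i, u i * φ (a i) := by
        simp only [Finset.mul_sum, mul_assoc]
      rw [this] at hv
      linear_combination hv
    obtain ⟨w', u', hw', rfl⟩ := h ι a u h1
    refine ⟨w + x ^ k • w', u', Submodule.add_mem _ hw (Submodule.smul_mem _ _ hw'), ?_⟩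
    rw [smul_add, smul_smul, pow_one, pow_succ, add_assoc]

theorem slice {R : Type} [CommRing R] [IsNoetherianRing R] [IsLocalRing R] (x : R)
    (hx : x ∈ nonZeroDivisors R) (hxm : x ∈ IsLocalRing.maximalIdeal R) (φ : R →+* R) (q : ℕ)
    (hq : 1 ≤ q)
    (hφ : φ x = x ^ q) (h : RelMod x φ 1) : RelProp φ := by
  have hmod := relMod_k x hx φ q hφ h q le_rfl
  have hxq : x ^ q ∈ nonZeroDivisors R := pow_mem hx q
  suffices H : ∀ A : Ideal R, ∀ (ι : Type) [Fintype ι] (a : ι → R), Ideal.span (Set.range a) = A →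
      ∀ s : ι → R, ∑ i, s i * φ (a i) = 0 → s ∈ syzSpan ⊥ φ a by
    intro ι _ a s hs
    exact H _ ι a rfl s hs
  intro A
  induction A using WellFoundedGT.induction with
  | ind A ih =>
  intro ι _ a hA
  let L : (ι → R) →ₗ[R] R := Fintype.linearCombination R (fun i => φ (a i))
  have hL : ∀ s, L s = ∑ i, s i * φ (a i) := fun s => by
    simp [L, Fintype.linearCombination_apply]
  suffices hS : LinearMap.ker L ≤ syzSpan ⊥ φ a by
    intro s hs
    exact hS (by rw [LinearMap.mem_ker, hL]; exact hs)
  have hle : syzSpan ⊥ φ a ≤ LinearMap.ker L := by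
    refine Submodule.span_le.2 ?_
    rintro _ ⟨b, hb, rfl⟩
    rw [SetLike.mem_coe, LinearMap.mem_ker, hL]
    simp only [← map_mul, ← map_sum]
    rw [Ideal.mem_bot.1 hb, map_zero]
  refine Submodule.le_of_le_smul_of_le_jacobson_bot (I := Ideal.span {x ^ q}) (IsNoetherian.noetherian _) ?_ ?_
  · rw [IsLocalRing.jacobson_eq_maximalIdeal _ bot_ne_top, Ideal.span_singleton_le_iff_mem]
    exact Ideal.pow_mem_of_mem _ hxm _ (by omega)
  intro s hs
  rw [LinearMap.mem_ker, hL] at hs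
  obtain ⟨w, u, hw, rfl⟩ := hmod ι a s (by rw [hs]; exact Ideal.zero_mem _)
  obtain ⟨n, t, b, c, hb, hwb, hwe⟩ := syz_eval x φ a w hw
  have h1 : ∑ k, t k * φ (c k) + ∑ i, u i * φ (a i) = 0 := by
    simp only [Pi.add_apply, Pi.smul_apply, smul_eq_mul, add_mul, Finset.sum_add_distrib, hwe, hφ,
      mul_assoc] at hs
    rw [← Finset.mul_sum, ← mul_add] at hs
    exact (mem_nonZeroDivisors_iff.1 hxq).1 _ hs
  by_cases hc : ∀ k, c k ∈ A
  · choose d hd using fun k => (Ideal.mem_span_range_iff_exists_fun).1 (hA ▸ hc k)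
    have e : w + x ^ q • u = (∑ k, t k • fun i => φ (b k i - x * d k i)) +
        x ^ q • (u + ∑ k, t k • fun i => φ (d k i)) := by
      ext i
      simp only [Pi.add_apply, Pi.smul_apply, Finset.sum_apply, smul_eq_mul, hwb, map_sub, map_mul, hφ,
        mul_add, mul_sub, Finset.sum_sub_distrib, Finset.mul_sum, mul_left_comm (x ^ q)]
      ring
    have m1 : (∑ k, t k • fun i => φ (b k i - x * d k i)) ∈ syzSpan ⊥ φ a := by
      refine Submodule.sum_mem _ fun k _ => Submodule.smul_mem _ _ (Submodule.subset_span ⟨_, ?_, rfl⟩)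
      simp only [sub_mul, Finset.sum_sub_distrib, hb, mul_assoc]
      rw [← Finset.mul_sum, hd]; simp
    rw [e]
    refine Submodule.add_mem_sup m1 (Submodule.smul_mem_smul (Ideal.mem_span_singleton_self _) ?_)
    rw [LinearMap.mem_ker, hL, ← h1]
    simp only [Pi.add_apply, Finset.sum_apply, Pi.smul_apply, smul_eq_mul, add_mul,
      Finset.sum_add_distrib]
    rw [add_comm]
    congr 1
    simp only [Finset.sum_mul]
    rw [Finset.sum_comm]
    refine Finset.sum_congr rfl fun k _ => ?_
    rw [← hd k, map_sum, Finset.mul_sum]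
    simp only [map_mul, mul_assoc]
  · refine Submodule.mem_sup_left ?_
    have hsum := ih (Ideal.span (Set.range (Sum.elim c a))) ?_ (Fin n ⊕ ι) (Sum.elim c a) rfl
      (Sum.elim t u) (by simpa [Fintype.sum_sum_type] using h1)
    · let T : ((Fin n ⊕ ι) → R) →ₗ[R] (ι → R) :=
        { toFun := fun v i => ∑ k, v (Sum.inl k) * φ (b k i) + x ^ q * v (Sum.inr i)
          map_add' := by
            intro v v'; ext i; simp [add_mul, Finset.sum_add_distrib, mul_add]; ring
          map_smul' := by
            intro r v; ext i; simp [mul_add, Finset.mul_sum, mul_assoc, mul_left_comm] }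
      have hT : w + x ^ q • u = T (Sum.elim t u) := by
        ext i; simp [T, hwb]
      rw [hT]
      have : syzSpan ⊥ φ (Sum.elim c a) ≤ (syzSpan ⊥ φ a).comap T := by
        refine Submodule.span_le.2 ?_
        rintro _ ⟨f, hf, rfl⟩
        refine Submodule.subset_span ⟨fun i => ∑ k, f (Sum.inl k) * b k i + x * f (Sum.inr i), ?_, ?_⟩
        · rw [Ideal.mem_bot] at hf ⊢
          simp only [Fintype.sum_sum_type, Sum.elim_inl, Sum.elim_inr] at hf
          simp only [add_mul, Finset.sum_add_distrib, Finset.sum_mul]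
          rw [Finset.sum_comm]
          simp only [mul_assoc, ← Finset.mul_sum, hb, mul_left_comm _ x]
          rw [← mul_add, hf, mul_zero]
        · ext i; simp [T, hφ]
      exact this hsum
    · push Not at hc
      obtain ⟨k, hk⟩ := hc
      refine lt_of_le_of_ne ?_ ?_
      · rw [← hA]; exact Ideal.span_mono (by rintro _ ⟨i, rfl⟩; exact ⟨Sum.inr i, rfl⟩)
      · intro he
        exact hk (he ▸ Ideal.subset_span ⟨Sum.inl k, rfl⟩)

theorem relProp_field {R : Type} [CommRing R] (hR : IsField R) (φ : R →+* R) : RelProp φ := by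
  let _ := hR.toField
  classical
  intro ι _ a s hs
  by_cases h : ∃ j, a j ≠ 0
  · obtain ⟨j, hj⟩ := h
    have e : s = ∑ i, s i • fun l => φ ((if l = i then 1 else 0) - if l = j then a i / a j else 0) := by
      ext l
      simp only [Finset.sum_apply, Pi.smul_apply, smul_eq_mul, map_sub, mul_sub,
        Finset.sum_sub_distrib]
      by_cases hl : l = j
      · subst hl
        have : ∑ i, s i * φ (a i / a l) = 0 := by
          simp only [div_eq_mul_inv, map_mul, ← mul_assoc, ← Finset.sum_mul, hs, zero_mul]
        simp only [map_div₀] at this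
        simp [this, apply_ite φ]
      · simp [hl, apply_ite φ]
    rw [e]
    refine Submodule.sum_mem _ fun i _ => Submodule.smul_mem _ _ (Submodule.subset_span ⟨_, ?_, rfl⟩)
    simp [sub_mul, Finset.sum_sub_distrib, hj]
  · push Not at h
    have e : s = ∑ i, s i • fun l => φ (if l = i then 1 else 0) := by
      ext l; simp [apply_ite φ]
    rw [e]
    exact Submodule.sum_mem _ fun i _ => Submodule.smul_mem _ _ (Submodule.subset_span ⟨_, by simp [h], rfl⟩)

open IsLocalRing in
theorem exists_param {R : Type} [CommRing R] [IsNoetherianRing R] [IsLocalRing R] (d : ℕ)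
    (g : Fin (d + 1) → R) (hg : Ideal.span (Set.range g) = maximalIdeal R)
    (hd : ringKrullDim R = (d + 1 : ℕ)) :
    ∃ x ∈ maximalIdeal R, (∀ p ∈ minimalPrimes R, x ∉ p) ∧
      ∃ (_ : IsLocalRing (R ⧸ Ideal.span {x})) (g' : Fin d → R ⧸ Ideal.span {x}),
        Ideal.span (Set.range g') = maximalIdeal (R ⧸ Ideal.span {x}) ∧
        ringKrullDim (R ⧸ Ideal.span {x}) = d := by
  classical
  have hfin : (minimalPrimes R).Finite := Ideal.finite_minimalPrimes_of_isNoetherianRing R ⊥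
  have hmin : maximalIdeal R ∉ minimalPrimes R := by
    intro h
    have := Ideal.height_eq_zero_iff.2 h
    have h2 := maximalIdeal_height_eq_ringKrullDim (R := R)
    rw [this, hd] at h2
    norm_cast at h2
  have hex : ∃ x ∈ maximalIdeal R, x ∉ maximalIdeal R ^ 2 ∧ ∀ p ∈ minimalPrimes R, x ∉ p := by
    by_contra hcon
    push Not at hcon
    have := (Ideal.subset_union_prime (s := insert (maximalIdeal R ^ 2) hfin.toFinset) (f := id)
      (maximalIdeal R ^ 2) (maximalIdeal R ^ 2) (by
        intro i hi h1 _
        rw [Finset.mem_insert] at hi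
        rcases hi with hi | hi
        · exact absurd hi h1
        · exact (hfin.mem_toFinset.1 hi).1.1) (I := maximalIdeal R)).1 (by
        intro x hx
        simp only [Set.mem_iUnion]
        by_cases h2 : x ∈ maximalIdeal R ^ 2
        · exact ⟨_, by simp, h2⟩
        · obtain ⟨p, hp, hxp⟩ := hcon x hx h2
          exact ⟨p, by simp [hp], hxp⟩)
    obtain ⟨i, hi, hle⟩ := this
    rw [Finset.mem_insert] at hi
    rcases hi with rfl | hi
    · have h0 : maximalIdeal R = ⊥ := by
        refine Submodule.eq_bot_of_le_smul_of_le_jacobson_bot (maximalIdeal R) _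
          (IsNoetherian.noetherian _) ?_ (maximalIdeal_le_jacobson _)
        simpa [pow_two] using hle
      have := ringKrullDim_eq_zero_of_isField (isField_iff_maximalIdeal_eq.2 h0)
      rw [hd] at this
      norm_cast at this
    · have hi' := hfin.mem_toFinset.1 hi
      have : i = maximalIdeal R := le_antisymm (le_maximalIdeal hi'.1.1.ne_top) hle
      exact hmin (this ▸ hi')
  obtain ⟨x, hx, hx2, hxp⟩ := hex
  have hne : Ideal.span {x} ≠ ⊤ := by
    rw [Ne, Ideal.span_singleton_eq_top]
    exact (mem_maximalIdeal x).1 hx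
  have hnt : Nontrivial (R ⧸ Ideal.span {x}) := Ideal.Quotient.nontrivial_iff.2 hne
  have hloc : IsLocalRing (R ⧸ Ideal.span {x}) :=
    IsLocalRing.of_surjective' (Ideal.Quotient.mk _) Ideal.Quotient.mk_surjective
  refine ⟨x, hx, hxp, hloc, ?_⟩
  obtain ⟨r, hr⟩ := Ideal.mem_span_range_iff_exists_fun.1 (hg ▸ hx)
  have hi : ∃ i, r i ∉ maximalIdeal R := by
    by_contra hcon
    push Not at hcon
    refine hx2 ?_
    rw [← hr, pow_two]
    exact Ideal.sum_mem _ fun i _ => Ideal.mul_mem_mul (hcon i) (hg ▸ Ideal.subset_span ⟨i, rfl⟩)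
  obtain ⟨i, hi⟩ := hi
  have hu : IsUnit (r i) := by simpa using hi
  let π := Ideal.Quotient.mk (Ideal.span {x})
  let g' : Fin d → R ⧸ Ideal.span {x} := fun j => π (g (i.succAbove j))
  have hmap : (maximalIdeal R).map π = maximalIdeal (R ⧸ Ideal.span {x}) :=
    map_maximalIdeal_of_surjective π Ideal.Quotient.mk_surjective
  have hg' : Ideal.span (Set.range g') = maximalIdeal (R ⧸ Ideal.span {x}) := by
    rw [← hmap, ← hg, Ideal.map_span]
    refine le_antisymm (Ideal.span_mono ?_) (Ideal.span_le.2 ?_)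
    · rintro _ ⟨j, rfl⟩
      exact ⟨_, ⟨_, rfl⟩, rfl⟩
    · rintro _ ⟨_, ⟨j, rfl⟩, rfl⟩
      rcases Fin.eq_self_or_eq_succAbove i j with rfl | ⟨j, rfl⟩
      · have h0 : π x = 0 := Ideal.Quotient.eq_zero_iff_mem.2 (Ideal.mem_span_singleton_self x)
        replace h0 : π (∑ i, r i * g i) = 0 := (congrArg π hr).trans h0
        rw [Fin.sum_univ_succAbove _ j, map_add, map_mul] at h0
        have h1 : π (r j) * π (g j) ∈ Ideal.span (Set.range g') := by
          rw [eq_neg_of_add_eq_zero_left h0, map_sum]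
          refine neg_mem (Ideal.sum_mem _ fun k _ => ?_)
          rw [map_mul]
          exact Ideal.mul_mem_left _ _ (Ideal.subset_span ⟨k, rfl⟩)
        exact (Ideal.unit_mul_mem_iff_mem _ (hu.map π)).1 h1
      · exact Ideal.subset_span ⟨j, rfl⟩
  refine ⟨g', hg', le_antisymm ?_ ?_⟩
  · refine (ringKrullDim_le_spanFinrank_maximalIdeal _).trans ?_
    rw [← hg']
    have h1 := Submodule.spanFinrank_span_le_ncard_of_finite (R := R ⧸ Ideal.span {x}) (Set.finite_range g')
    have h2 : (Set.range g').ncard ≤ d := by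
      rw [← Set.image_univ]
      refine (Set.ncard_image_le Set.finite_univ).trans ?_
      simp [Set.ncard_univ]
    exact_mod_cast h1.trans h2
  · have h1 := Ideal.height_le_ringKrullDim_quotient_add_one hx
    rw [maximalIdeal_height_eq_ringKrullDim, hd] at h1
    push_cast at h1
    exact ENat.WithBot.add_le_add_one_right_iff.1 h1

open IsLocalRing in
theorem relProp_regular (q : ℕ) (hq : 1 ≤ q) (d : ℕ) : ∀ (R : Type) [CommRing R] [IsNoetherianRing R]
    [IsLocalRing R] (g : Fin d → R), Ideal.span (Set.range g) = maximalIdeal R →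
    ringKrullDim R = d → IsDomain R ∧ ∀ φ : R →+* R, (∀ x, φ x = x ^ q) → RelProp φ := by
  induction d with
  | zero =>
    intro R _ _ _ g hg _
    have h0 : maximalIdeal R = ⊥ := by rw [← hg]; simp
    have hF := isField_iff_maximalIdeal_eq.2 h0
    exact ⟨hF.isDomain, fun φ _ => relProp_field hF φ⟩
  | succ d ih =>
    intro R _ _ _ g hg hd
    obtain ⟨x, hx, hxp, _, g', hg', hd'⟩ := exists_param d g hg hd
    obtain ⟨hdom, hrel⟩ := ih (R ⧸ Ideal.span {x}) g' hg' hd'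
    have hprime : (Ideal.span {x}).IsPrime := (Ideal.Quotient.isDomain_iff_prime _).1 hdom
    have hD : IsDomain R := by
      obtain ⟨p, hp, hpx⟩ := Ideal.exists_minimalPrimes_le (I := ⊥) (J := Ideal.span {x}) bot_le
      have hpp : p.IsPrime := hp.1.1
      have : p = ⊥ := by
        refine Submodule.eq_bot_of_le_smul_of_le_jacobson_bot (maximalIdeal R) _
          (IsNoetherian.noetherian _) ?_ (maximalIdeal_le_jacobson _)
        intro y hy
        obtain ⟨z, rfl⟩ := Ideal.mem_span_singleton'.1 (hpx hy)
        have hz := (hpp.mem_or_mem hy).resolve_right (hxp p hp)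
        rw [mul_comm]
        exact Submodule.smul_mem_smul hx hz
      subst this
      exact IsDomain.of_bot_isPrime R
    refine ⟨hD, fun φ hφ => ?_⟩
    have hx0 : x ≠ 0 := by
      rintro rfl
      obtain ⟨p, hp, _⟩ := Ideal.exists_minimalPrimes_le (I := ⊥) (J := maximalIdeal R) bot_le
      exact hxp p hp (zero_mem p)
    let ψ : R ⧸ Ideal.span {x} →+* R ⧸ Ideal.span {x} := Ideal.quotientMap (Ideal.span {x}) φ (by
      rw [Ideal.span_singleton_le_iff_mem, Ideal.mem_comap, hφ]
      exact Ideal.pow_mem_of_mem _ (Ideal.mem_span_singleton_self x) _ (by omega))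
    have hψ : ∀ r, ψ (Ideal.Quotient.mk _ r) = Ideal.Quotient.mk _ (φ r) := fun r =>
      Ideal.quotientMap_mk
    refine slice x (mem_nonZeroDivisors_of_ne_zero hx0) hx φ q hq (hφ x)
      (relMod_one x φ ψ hψ (hrel ψ fun y => ?_))
    obtain ⟨y, rfl⟩ := Ideal.Quotient.mk_surjective y
    rw [hψ, hφ, map_pow]

theorem inter_of_relProp {R : Type} [CommRing R] (φ : R →+* R) (h : RelProp φ) (I J : Ideal R) :
    I.map φ ⊓ J.map φ ≤ (I ⊓ J).map φ := by
  rintro z ⟨hI, hJ⟩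
  obtain ⟨n, s, g, hg⟩ := Submodule.mem_span_set'.1 hI
  obtain ⟨m, t, k, hk⟩ := Submodule.mem_span_set'.1 hJ
  choose a ha ha' using fun i => (g i).2
  choose b hb hb' using fun i => (k i).2
  have h1 := h (Fin n ⊕ Fin m) (Sum.elim a (fun i => - b i)) (Sum.elim s t) (by
    simp only [smul_eq_mul, ← ha', ← hb'] at hg hk
    simp [Fintype.sum_sum_type, hg, hk])
  let L : ((Fin n ⊕ Fin m) → R) →ₗ[R] R :=
    (Fintype.linearCombination R (fun i => φ (a i))).comp (LinearMap.funLeft R R Sum.inl)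
  have hL : ∀ v, L v = ∑ i, v (Sum.inl i) * φ (a i) := fun v => by
    simp [L, Fintype.linearCombination_apply, LinearMap.funLeft_apply]
  have h2 : syzSpan ⊥ φ (Sum.elim a (fun i => - b i)) ≤ Submodule.comap L ((I ⊓ J).map φ : Ideal R) := by
    refine Submodule.span_le.2 ?_
    rintro _ ⟨f, hf, rfl⟩
    rw [SetLike.mem_coe, Submodule.mem_comap, hL]
    simp only [← map_mul, ← map_sum]
    refine Ideal.mem_map_of_mem _ ⟨Ideal.sum_mem _ fun i _ => Ideal.mul_mem_left _ _ (ha i), ?_⟩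
    simp only [Ideal.mem_bot, Fintype.sum_sum_type, Sum.elim_inl, Sum.elim_inr, mul_neg,
      Finset.sum_neg_distrib, ← sub_eq_add_neg, sub_eq_zero] at hf
    rw [hf]
    exact Ideal.sum_mem _ fun i _ => Ideal.mul_mem_left _ _ (hb i)
  have h3 := h2 h1
  rw [Submodule.mem_comap, hL] at h3
  simp only [smul_eq_mul, ← ha'] at hg
  rw [← hg]
  simpa using h3

theorem frobPow_eq_map {R : Type} [CommRing R] (φ : R →+* R) (q : ℕ) (hφ : ∀ x, φ x = x ^ q)
    (I : Ideal R) : frobPow I q = I.map φ := by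
  unfold frobPow Ideal.map
  congr 1
  ext x
  simp [hφ]

theorem inter_regular (P : Type) [CommRing P] (hP : IsRegularCommRing P)
    (p : ℕ) [Fact p.Prime] [CharP P p] (e : ℕ) (I J : Ideal P) :
    I.map (iterateFrobenius P p e) ⊓ J.map (iterateFrobenius P p e) ≤
      (I ⊓ J).map (iterateFrobenius P p e) := by
  have := hP.1
  refine Ideal.le_of_localization_maximal fun m hm => ?_
  have hprime := hm.isPrime
  obtain ⟨s, hs, hs'⟩ := hP.2 m hprime
  let R := Localization.AtPrime m
  have hN : IsNoetherianRing R := IsLocalization.isNoetherianRing m.primeCompl R hP.1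
  have hp0 : (p : R) = 0 := by
    have : (p : R) = algebraMap P R (p : P) := (map_natCast (algebraMap P R) p).symm
    rw [this, CharP.cast_eq_zero, map_zero]
  have hch : CharP R p := ringChar.of_eq (CharP.ringChar_of_prime_eq_zero Fact.out hp0)
  have hcomm : (algebraMap P R).comp (iterateFrobenius P p e) =
      (iterateFrobenius R p e).comp (algebraMap P R) := by
    ext x
    exact RingHom.map_iterateFrobenius (algebraMap P R) p x e
  have hm' : ∀ K : Ideal P, (K.map (iterateFrobenius P p e)).map (algebraMap P R) =
      (K.map (algebraMap P R)).map (iterateFrobenius R p e) := fun K => by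
    rw [Ideal.map_map, Ideal.map_map, hcomm]
  have hpos : 1 ≤ p ^ e := Nat.one_le_pow _ _ (Fact.out : p.Prime).pos
  have hrel := (relProp_regular (p ^ e) hpos s.card R (fun i => (s.equivFin.symm i : R)) (by
    rw [← hs]
    congr 1
    ext y
    constructor
    · rintro ⟨i, rfl⟩
      exact (s.equivFin.symm i).2
    · intro hy
      exact ⟨s.equivFin ⟨y, hy⟩, by simp⟩) hs'.symm).2 (iterateFrobenius R p e) (fun x => rfl)
  change Ideal.map (algebraMap P R) _ ≤ Ideal.map (algebraMap P R) _
  rw [IsLocalization.map_inf m.primeCompl R, hm', hm', hm', IsLocalization.map_inf m.primeCompl R]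
  exact inter_of_relProp _ hrel _ _

theorem combi {P : Type} [CommRing P] (q : ℕ) (hq : 1 ≤ q) (c : ℕ) (f : Fin c → P)
    (C J Cq : Ideal P) (hC : C = Ideal.span (Set.range f)) (hCq : ∀ i, f i ^ q ∈ Cq)
    (hcolon : ∀ u, u * (∏ i, f i) ^ (q - 1) ∈ Cq ⊔ J → u ∈ C ⊔ J) :
    J ⊓ C ≤ Cq ⊔ C * J := by
  have hfC : ∀ i, f i ∈ C := fun i => hC ▸ Ideal.subset_span ⟨i, rfl⟩
  have hbig : ∀ (a : Fin c → ℕ), (∃ i, q ≤ a i) → ∏ i, f i ^ a i ∈ Cq := by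
    rintro a ⟨i, hi⟩
    have : f i ^ q ∣ ∏ i, f i ^ a i :=
      (pow_dvd_pow _ hi).trans (Finset.dvd_prod_of_mem (fun i => f i ^ a i) (Finset.mem_univ i))
    exact Ideal.mem_of_dvd _ this (hCq i)
  have hdeg : ∀ (a : Fin c →₀ ℕ) (d : ℕ), a.degree = d → ∏ i, f i ^ a i ∈ C ^ d := by
    rintro a d rfl
    rw [Finsupp.degree_eq_sum, ← Finset.prod_pow_eq_pow_sum]
    exact Ideal.prod_mem_prod fun i _ => Ideal.pow_mem_pow (hfC i) _
  have key : ∀ d, J ⊓ C ≤ Cq ⊔ C * J ⊔ C ^ (d + 1) := by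
    intro d
    induction d with
    | zero => exact fun x hx => Submodule.mem_sup_right (by simpa using hx.2)
    | succ d ih =>
      intro x hx
      obtain ⟨w, hw, z, hz, rfl⟩ := Submodule.mem_sup.1 (ih hx)
      have hzJ : z ∈ Cq ⊔ J := by
        have h1 : w ∈ Cq ⊔ J := (sup_le_sup le_rfl Ideal.mul_le_right : Cq ⊔ C * J ≤ Cq ⊔ J) hw
        have := sub_mem (show w + z ∈ Cq ⊔ J from Submodule.mem_sup_right hx.1) h1
        simpa using this
      refine add_mem (Submodule.mem_sup_left hw) ?_
      have hz' := hz
      rw [hC, Ideal.mem_span_pow_iff_exists_isHomogeneous] at hz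
      obtain ⟨F, hF, rfl⟩ := hz
      rw [MvPolynomial.eval_eq'] at hzJ ⊢
      refine Ideal.sum_mem _ fun a ha => ?_
      by_cases hbg : ∃ i, q ≤ a i
      · exact Submodule.mem_sup_left (Submodule.mem_sup_left (Ideal.mul_mem_left _ _ (hbig a hbg)))
      push Not at hbg
      have hdega : ∀ b ∈ F.support, b.degree = d + 1 := fun b hb => by
        have := hF (MvPolynomial.mem_support_iff.1 hb)
        exact (congrArg (fun g => g b) (Finsupp.degree_eq_weight_one (σ := Fin c) (R := ℕ))).trans this
      have hu : F.coeff a ∈ C ⊔ J := by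
        apply hcolon
        have h1 := Ideal.mul_mem_right (∏ i, f i ^ (q - 1 - a i)) _ hzJ
        rw [← Finset.add_sum_erase _ _ ha, add_mul, mul_assoc, ← Finset.prod_mul_distrib] at h1
        have h2 : ∏ i, f i ^ a i * f i ^ (q - 1 - a i) = (∏ i, f i) ^ (q - 1) := by
          rw [← Finset.prod_pow]
          refine Finset.prod_congr rfl fun i _ => ?_
          rw [← pow_add]; congr 1; have := hbg i; omega
        rw [h2] at h1
        refine (Submodule.add_mem_iff_left _ (Submodule.mem_sup_left ?_)).1 h1
        rw [Finset.sum_mul]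
        refine Ideal.sum_mem _ fun b hb => ?_
        rw [mul_assoc, ← Finset.prod_mul_distrib]
        refine Ideal.mul_mem_left _ _ ?_
        simp only [← pow_add]
        refine hbig _ ?_
        rw [Finset.mem_erase] at hb
        by_contra hcon
        push Not at hcon
        refine hb.1 ?_
        have hle : b ≤ a := fun i => by have := hcon i; have := hbg i; omega
        have hsum : ∑ i, b i = ∑ i, a i := by
          rw [← Finsupp.degree_eq_sum, ← Finsupp.degree_eq_sum, hdega b hb.2, hdega a ha]
        ext i
        exact (Finset.sum_eq_sum_iff_of_le (fun i _ => hle i)).1 hsum i (Finset.mem_univ i)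
      obtain ⟨y, hy, j, hj, hyj⟩ := Submodule.mem_sup.1 hu
      rw [← hyj, add_mul]
      have hm := hdeg a _ (hdega a ha)
      refine add_mem (Submodule.mem_sup_right ?_) (Submodule.mem_sup_left (Submodule.mem_sup_right ?_))
      · rw [pow_succ']
        exact Ideal.mul_mem_mul hy hm
      · rw [mul_comm j]
        exact Ideal.mul_mem_mul (Ideal.pow_le_self (Nat.succ_ne_zero d) hm) hj
  have hlast : C ^ (c * q + 1) ≤ Cq := by
    intro z hz
    rw [hC, Ideal.mem_span_pow_iff_exists_isHomogeneous] at hz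
    obtain ⟨F, hF, rfl⟩ := hz
    rw [MvPolynomial.eval_eq']
    refine Ideal.sum_mem _ fun a ha => Ideal.mul_mem_left _ _ (hbig a ?_)
    have := hF (MvPolynomial.mem_support_iff.1 ha)
    replace this := (congrArg (fun g => g a) (Finsupp.degree_eq_weight_one (σ := Fin c) (R := ℕ))).trans this
    simp only [Finsupp.degree_eq_sum] at this
    by_contra hcon
    push Not at hcon
    have h2 : ∑ i, a i ≤ ∑ i : Fin c, q := Finset.sum_le_sum fun i _ => (hcon i).le
    simp at h2
    omega
  refine (key (c * q)).trans (sup_le le_rfl (hlast.trans le_sup_left))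

/-- **Proposition 5.1.** Let `P` be a regular commutative ring of positive characteristic `p`,
`q = p^e`, and `C, I` ideals of `P` with `C` generated by a regular sequence `f 0, …, f (c-1)`.
Set `y = (f 0 ⋯ f (c-1))^(q-1)`.  If `(C + I)^{[q]} : y = C + I^{[q]}`, then
`I^{[q]} ∩ C = (I ∩ C)^{[q]} + C·I^{[q]}`. -/
theorem socle_degrees_stmt3
    (P : Type) [CommRing P] (hP : IsRegularCommRing P)
    (p : ℕ) [Fact p.Prime] [CharP P p] (e : ℕ) (q : ℕ) (hq : q = p ^ e)
    (c : ℕ) (f : Fin c → P)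
    (hreg : RingTheory.Sequence.IsRegular P (List.ofFn f))
    (C I : Ideal P) (hC : C = Ideal.span (Set.range f))
    (hcolon : (frobPow (C + I) q).colon (Ideal.span {(∏ i, f i) ^ (q - 1)}) =
      C + frobPow I q) :
    frobPow I q ⊓ C = frobPow (I ⊓ C) q + C * frobPow I q := by
  have hφ : ∀ x, iterateFrobenius P p e x = x ^ q := fun x => by rw [hq]; rfl
  have hpos : 1 ≤ q := by rw [hq]; exact Nat.one_le_pow _ _ (Fact.out : p.Prime).pos
  have hint := inter_regular P hP p e I C
  simp only [frobPow_eq_map _ q hφ] at hcolon ⊢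
  set φ := iterateFrobenius P p e
  simp only [Submodule.add_eq_sup] at hcolon ⊢
  rw [Ideal.map_sup] at hcolon
  have h1 := combi q hpos c f C (I.map φ) (C.map φ) hC
    (fun i => by rw [← hφ]; exact Ideal.mem_map_of_mem _ (hC ▸ Ideal.subset_span ⟨i, rfl⟩))
    (fun u hu => by rw [← hcolon, Ideal.mem_colon_span_singleton]; exact hu)
  apply le_antisymm
  · intro x hx
    obtain ⟨w, hw, z, hz, rfl⟩ := Submodule.mem_sup.1 (h1 hx)
    refine Submodule.add_mem_sup (hint ⟨?_, hw⟩) hz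
    have := sub_mem hx.1 (Ideal.mul_le_right hz : z ∈ I.map φ)
    simpa using this
  · refine sup_le (le_inf (Ideal.map_mono inf_le_left) ?_) (le_inf Ideal.mul_le_right Ideal.mul_le_left)
    refine Ideal.map_le_iff_le_comap.2 fun x hx => ?_
    rw [Ideal.mem_comap, hφ]
    exact Ideal.pow_mem_of_mem _ hx.2 _ (by omega)
end
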